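/- arXiv:1802.09056 — 3 statements merged into one kernel-verified Lean document; each statement's English description precedes it below -/
import Mathlib

section
/- Let λ₁,…,λₙ be distinct points in the open unit disc 𝔻 and let (x₁ᵏ,x₂ᵏ,x₃ᵏ) ∈ E for k = 1,…,n. Then the following are equivalent: (1) there exists an analytic map x : 𝔻 → ℂ³ with x(𝔻) ⊆ Ē and x(λₖ) = (x₁ᵏ,x₂ᵏ,x₃ᵏ) for k = 1,…,n; (2) there exist complex numbers b₁,…,bₙ and c₁,…,cₙ with bₖcₖ = x₁ᵏx₂ᵏ − x₃ᵏ for k = 1,…,n, and an analytic function F : 𝔻 → ℂ^{2×2} with ‖F(λ)‖ ≤ 1 for all λ ∈ 𝔻 such that F(λₖ) = [[x₁ᵏ, bₖ],[cₖ, x₂ᵏ]] for k = 1,…,n. -/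
/-- The closed tetrablock. -/
def closedTetra : Set (ℂ × ℂ × ℂ) :=
  {x | ∀ z ∈ Metric.ball (0:ℂ) 1, ∀ w ∈ Metric.ball (0:ℂ) 1,
        1 - x.1 * z - x.2.1 * w + x.2.2 * z * w ≠ 0}

/-- The open tetrablock. -/
def openTetra : Set (ℂ × ℂ × ℂ) :=
  {x | ∀ z ∈ Metric.closedBall (0:ℂ) 1, ∀ w ∈ Metric.closedBall (0:ℂ) 1,
        1 - x.1 * z - x.2.1 * w + x.2.2 * z * w ≠ 0}

/-- The operator norm of a 2×2 complex matrix with respect to the Euclidean norm on ℂ². -/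
noncomputable def opNorm2 (A : Matrix (Fin 2) (Fin 2) ℂ) : ℝ :=
  ‖Matrix.toEuclideanCLM (𝕜 := ℂ) A‖

open ComplexConjugate Metric Filter Topology Polynomial

/-- The matrix `!![a, b; c, d]` is a contraction of Euclidean `ℂ²`. -/
def IsContraction2 (a b c d : ℂ) : Prop :=
  ∀ u v : ℂ, ‖a * u + b * v‖ ^ 2 + ‖c * u + d * v‖ ^ 2 ≤ ‖u‖ ^ 2 + ‖v‖ ^ 2

lemma isContraction2_of_trace_det {a b c d : ℂ} (hdet : ‖a * d - b * c‖ ≤ 1)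
    (htr : ‖a‖ ^ 2 + ‖b‖ ^ 2 + ‖c‖ ^ 2 + ‖d‖ ^ 2 ≤ 1 + ‖a * d - b * c‖ ^ 2) :
    IsContraction2 a b c d := by
  intro u v
  set P := 1 - ‖a‖ ^ 2 - ‖c‖ ^ 2 with hP
  set R := 1 - ‖b‖ ^ 2 - ‖d‖ ^ 2 with hR
  set Q := conj a * b + conj c * d with hQ
  have hPRQ : P * R - ‖Q‖ ^ 2 =
      1 + ‖a * d - b * c‖ ^ 2 - (‖a‖ ^ 2 + ‖b‖ ^ 2 + ‖c‖ ^ 2 + ‖d‖ ^ 2) := by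
    simp only [hP, hR, hQ, Complex.sq_norm, Complex.normSq_apply, Complex.add_re, Complex.add_im,
      Complex.sub_re, Complex.sub_im, Complex.mul_re, Complex.mul_im, Complex.conj_re,
      Complex.conj_im]
    ring
  have hform : ‖u‖ ^ 2 + ‖v‖ ^ 2 - (‖a * u + b * v‖ ^ 2 + ‖c * u + d * v‖ ^ 2) =
      P * ‖u‖ ^ 2 + R * ‖v‖ ^ 2 - 2 * (Q * (conj u * v)).re := by
    simp only [hP, hR, hQ, Complex.sq_norm, Complex.normSq_apply, Complex.add_re, Complex.add_im,
      Complex.mul_re, Complex.mul_im, Complex.conj_re, Complex.conj_im]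
    ring
  have hre : (Q * (conj u * v)).re ≤ ‖Q‖ * (‖u‖ * ‖v‖) := by
    simpa using Complex.re_le_norm (Q * (conj u * v))
  have hPR : ‖Q‖ ^ 2 ≤ P * R := by linarith
  have hdet2 : ‖a * d - b * c‖ ^ 2 ≤ 1 := by
    have := norm_nonneg (a * d - b * c)
    nlinarith
  have hsum : 0 ≤ P + R := by linarith
  have hPR0 : 0 ≤ P * R := (sq_nonneg _).trans hPR
  have hP0 : 0 ≤ P := by
    by_contra! h
    nlinarith
  have hR0 : 0 ≤ R := by
    by_contra! h
    nlinarith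
  have key : 2 * (‖Q‖ * (‖u‖ * ‖v‖)) ≤ P * ‖u‖ ^ 2 + R * ‖v‖ ^ 2 := by
    refine (abs_le_of_sq_le_sq' ?_ (by positivity)).2
    have h1 : ‖Q‖ ^ 2 * (‖u‖ * ‖v‖) ^ 2 ≤ P * R * (‖u‖ * ‖v‖) ^ 2 := by gcongr
    nlinarith [sq_nonneg (P * ‖u‖ ^ 2 - R * ‖v‖ ^ 2)]
  linarith

lemma opNorm2_le_one_iff {a b c d : ℂ} :
    opNorm2 !![a, b; c, d] ≤ 1 ↔ IsContraction2 a b c d := by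
  rw [opNorm2, ContinuousLinearMap.opNorm_le_iff zero_le_one]
  constructor
  · intro h u v
    have := pow_le_pow_left₀ (norm_nonneg _) (h !₂[u, v]) 2
    simpa [EuclideanSpace.norm_sq_eq, Matrix.ofLp_toEuclideanCLM, Matrix.mulVec,
      dotProduct, mul_comm] using this
  · intro h x
    have := h (x 0) (x 1)
    rw [one_mul]
    refine (abs_le_of_sq_le_sq' ?_ (norm_nonneg _)).2
    simpa [EuclideanSpace.norm_sq_eq, Matrix.ofLp_toEuclideanCLM, Matrix.mulVec,
      dotProduct] using this

/-- If `A` is a contraction, then `det (1 - A * diag(z, w)) ≠ 0` for `z`, `w` in the unit disc. -/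
lemma IsContraction2.pencil_ne_zero {a b c d : ℂ} (h : IsContraction2 a b c d) {z w : ℂ}
    (hz : ‖z‖ < 1) (hw : ‖w‖ < 1) : 1 - a * z - d * w + (a * d - b * c) * z * w ≠ 0 := by
  intro h0
  have main : ∀ u v : ℂ, a * (z * u) + b * (w * v) = u → c * (z * u) + d * (w * v) = v →
      u = 0 ∧ v = 0 := by
    intro u v h1 h2
    have := h (z * u) (w * v)
    rw [h1, h2, norm_mul, norm_mul, mul_pow, mul_pow] at this
    have hz2 : ‖z‖ ^ 2 < 1 := by have := norm_nonneg z; nlinarith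
    have hw2 : ‖w‖ ^ 2 < 1 := by have := norm_nonneg w; nlinarith
    constructor
    · by_contra hu
      have : 0 < ‖u‖ ^ 2 := by positivity
      nlinarith [sq_nonneg ‖v‖]
    · by_contra hv
      have : 0 < ‖v‖ ^ 2 := by positivity
      nlinarith [sq_nonneg ‖u‖]
  obtain ⟨hbw, haz⟩ := main (b * w) (1 - a * z) (by ring) (by linear_combination (-1) * h0)
  obtain ⟨hdw, -⟩ := main (1 - d * w) (c * z) (by linear_combination (-1) * h0) (by ring)
  have h1 := main 1 0 (by linear_combination (-1) * haz)
  have h2 := main 0 1 (by linear_combination hbw)  (by linear_combination (-1) * hdw)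
  simp at h2

lemma norm_le_one_of_forall_ne {p q : ℂ} (h : ∀ w : ℂ, ‖w‖ < 1 → p - q * w ≠ 0) :
    ‖q‖ ≤ ‖p‖ := by
  by_contra! hlt
  have hq : q ≠ 0 := by
    rintro rfl
    simp at hlt
    exact absurd hlt (norm_nonneg p).not_gt
  refine h (p / q) ?_ (by field_simp; ring)
  rw [norm_div, div_lt_one (by positivity)]
  exact hlt

/-- The inequalities describing the closed tetrablock. -/
def TetraIneq (x₁ x₂ x₃ : ℂ) : Prop :=
  ‖x₃‖ ≤ 1 ∧ ‖x₁‖ ^ 2 + ‖x₂‖ ^ 2 + 2 * ‖x₁ * x₂ - x₃‖ ≤ 1 + ‖x₃‖ ^ 2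

lemma two_mul_norm_le_of_pencil {x₁ x₂ x₃ : ℂ}
    (h : ∀ z : ℂ, ‖z‖ < 1 → ∀ w : ℂ, ‖w‖ < 1 → 1 - x₁ * z - x₂ * w + x₃ * z * w ≠ 0) :
    2 * ‖x₁ - conj x₂ * x₃‖ ≤ 1 + ‖x₁‖ ^ 2 - ‖x₂‖ ^ 2 - ‖x₃‖ ^ 2 := by
  have hopen : ∀ z ∈ Metric.ball (0 : ℂ) 1, ‖x₂ - x₃ * z‖ ≤ ‖1 - x₁ * z‖ := by
    intro z hz
    refine norm_le_one_of_forall_ne fun w hw h0 ↦ h z (by simpa using hz) w hw ?_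
    linear_combination h0
  have hcl : ∀ z ∈ closure (Metric.ball (0 : ℂ) 1), ‖x₂ - x₃ * z‖ ≤ ‖1 - x₁ * z‖ :=
    fun z hz ↦ le_on_closure hopen (by fun_prop) (by fun_prop) hz
  rw [closure_ball _ one_ne_zero] at hcl
  set s := x₁ - conj x₂ * x₃ with hs
  obtain ⟨z, hz1, hzs⟩ : ∃ z : ℂ, ‖z‖ = 1 ∧ z * s = ‖s‖ := by
    by_cases hs0 : s = 0
    · exact ⟨1, by simp, by simp [hs0]⟩
    · have : (‖s‖ : ℂ) ≠ 0 := by simpa using hs0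
      refine ⟨conj s / ‖s‖, by simp [hs0], ?_⟩
      rw [div_mul_eq_mul_div, Complex.conj_mul', sq]
      field_simp
  have hle := pow_le_pow_left₀ (norm_nonneg _) (hcl z (by simp [hz1])) 2
  have hid : ‖1 - x₁ * z‖ ^ 2 - ‖x₂ - x₃ * z‖ ^ 2 =
      1 - ‖x₂‖ ^ 2 + (‖x₁‖ ^ 2 - ‖x₃‖ ^ 2) * ‖z‖ ^ 2 - 2 * (z * s).re := by
    simp only [hs, Complex.sq_norm, Complex.normSq_apply, Complex.sub_re, Complex.sub_im,
      Complex.mul_re, Complex.mul_im, Complex.conj_re, Complex.conj_im, Complex.one_re, Complex.one_im]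
    ring
  rw [hzs, hz1, Complex.ofReal_re] at hid
  linarith

lemma tetraIneq_of_pencil {x₁ x₂ x₃ : ℂ}
    (h : ∀ z : ℂ, ‖z‖ < 1 → ∀ w : ℂ, ‖w‖ < 1 → 1 - x₁ * z - x₂ * w + x₃ * z * w ≠ 0) :
    TetraIneq x₁ x₂ x₃ := by
  have hA := two_mul_norm_le_of_pencil h
  have hB := two_mul_norm_le_of_pencil (x₁ := x₂) (x₂ := x₁) (x₃ := x₃) fun z hz w hw h0 ↦
    h w hw z hz (by linear_combination h0)
  have h3 : ‖x₃‖ ≤ 1 := by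
    have := norm_nonneg (x₁ - conj x₂ * x₃)
    have := norm_nonneg (x₂ - conj x₁ * x₃)
    nlinarith [norm_nonneg x₃]
  have h1 : ‖x₁‖ ≤ 1 := by
    simpa using norm_le_one_of_forall_ne (p := 1) (q := x₁) fun z hz h0 ↦
      h z hz 0 (by simp) (by simpa using h0)
  have h2 : ‖x₂‖ ≤ 1 := by
    simpa using norm_le_one_of_forall_ne (p := 1) (q := x₂) fun z hz h0 ↦
      h 0 (by simp) z hz (by simpa using h0)
  refine ⟨h3, ?_⟩
  have hA1 : ‖x₁‖ - ‖x₂‖ * ‖x₃‖ ≤ ‖x₁ - conj x₂ * x₃‖ := by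
    simpa using norm_sub_norm_le x₁ (conj x₂ * x₃)
  have hA2 : ‖x₂‖ * ‖x₃‖ - ‖x₁‖ ≤ ‖x₁ - conj x₂ * x₃‖ := by
    simpa [norm_sub_rev] using norm_sub_norm_le (conj x₂ * x₃) x₁
  have hB2 : ‖x₁‖ * ‖x₃‖ - ‖x₂‖ ≤ ‖x₂ - conj x₁ * x₃‖ := by
    simpa [norm_sub_rev] using norm_sub_norm_le (conj x₁ * x₃) x₂
  have hid : (1 + ‖x₁‖ ^ 2 - ‖x₂‖ ^ 2 - ‖x₃‖ ^ 2) ^ 2 - 4 * ‖x₁ - conj x₂ * x₃‖ ^ 2 =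
      (1 + ‖x₃‖ ^ 2 - ‖x₁‖ ^ 2 - ‖x₂‖ ^ 2) ^ 2 - 4 * ‖x₁ * x₂ - x₃‖ ^ 2 := by
    simp only [Complex.sq_norm, Complex.normSq_apply, Complex.sub_re, Complex.sub_im,
      Complex.mul_re, Complex.mul_im, Complex.conj_re, Complex.conj_im]
    ring
  have hA' := pow_le_pow_left₀ (by positivity) hA 2
  have a0 := norm_nonneg x₁
  have b0 := norm_nonneg x₂
  have c0 := norm_nonneg x₃
  have e1 : |‖x₂‖ - ‖x₃‖| ≤ |1 - ‖x₁‖| := sq_le_sq.1 (by linarith)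
  rw [abs_of_nonneg (sub_nonneg.2 h1)] at e1
  have e2 : |‖x₂‖ + ‖x₃‖| ≤ |1 + ‖x₁‖| := sq_le_sq.1 (by linarith)
  rw [abs_of_nonneg (by positivity), abs_of_nonneg (by positivity)] at e2
  have e3 : |‖x₁‖ + ‖x₃‖| ≤ |1 + ‖x₂‖| := sq_le_sq.1 (by linarith)
  rw [abs_of_nonneg (by positivity), abs_of_nonneg (by positivity)] at e3
  have hsgn : 0 ≤ 1 + ‖x₃‖ ^ 2 - ‖x₁‖ ^ 2 - ‖x₂‖ ^ 2 := by
    have f1 : (‖x₁‖ + ‖x₂‖) ^ 2 ≤ (1 + ‖x₃‖) ^ 2 := by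
      have := (abs_le.1 e1).2
      gcongr ?_ ^ 2
      linarith
    have f2 : (‖x₁‖ - ‖x₂‖) ^ 2 ≤ (1 - ‖x₃‖) ^ 2 := by
      refine sq_le_sq' ?_ ?_ <;> linarith
    linarith
  have := (abs_le_of_sq_le_sq' (a := 2 * ‖x₁ * x₂ - x₃‖) (by linarith) hsgn).2
  linarith

/-- Dilating the closed tetrablock moves it into a set described by strict inequalities. -/
lemma TetraIneq.dilate {x₁ x₂ x₃ : ℂ} (h : TetraIneq x₁ x₂ x₃) {t : ℝ} (ht0 : 0 ≤ t)
    (ht1 : t < 1) :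
    ‖(t ^ 2 * x₃ : ℂ)‖ < 1 ∧ ‖(t * x₁ : ℂ)‖ ^ 2 + ‖(t * x₂ : ℂ)‖ ^ 2 +
      2 * ‖(t * x₁ * (t * x₂) - t ^ 2 * x₃ : ℂ)‖ < 1 + ‖(t ^ 2 * x₃ : ℂ)‖ ^ 2 := by
  obtain ⟨h3, h⟩ := h
  have e : (t * x₁ * (t * x₂) - t ^ 2 * x₃ : ℂ) = t ^ 2 * (x₁ * x₂ - x₃) := by ring
  have c0 := norm_nonneg x₃
  have t2 : t ^ 2 < 1 := by nlinarith
  rw [e]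
  simp only [norm_mul, norm_pow, Complex.norm_real, Real.norm_of_nonneg ht0]
  refine ⟨by nlinarith, ?_⟩
  have c2 : ‖x₃‖ ^ 2 ≤ 1 := by nlinarith
  have : 0 < (1 - t ^ 2) * (1 - t ^ 2 * ‖x₃‖ ^ 2) := by
    apply mul_pos <;> nlinarith [sq_nonneg t]
  nlinarith [mul_le_mul_of_nonneg_left h (sq_nonneg t)]

/-- `h` is a product of two functions in the disc algebra with equal moduli on the unit circle. -/
def SplitsEvenly (h : ℂ → ℂ) : Prop :=
  ∃ f g : ℂ → ℂ, DiffContOnCl ℂ f (ball 0 1) ∧ DiffContOnCl ℂ g (ball 0 1) ∧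
    (∀ z ∈ closedBall (0 : ℂ) 1, f z * g z = h z) ∧ ∀ z ∈ sphere (0 : ℂ) 1, ‖f z‖ = ‖g z‖

lemma SplitsEvenly.mul {h k : ℂ → ℂ} (hh : SplitsEvenly h) (hk : SplitsEvenly k) :
    SplitsEvenly (fun z ↦ h z * k z) := by
  obtain ⟨f, g, hf, hg, hfg, hn⟩ := hh
  obtain ⟨f', g', hf', hg', hfg', hn'⟩ := hk
  refine ⟨fun z ↦ f z * f' z, fun z ↦ g z * g' z, hf.smul hf', hg.smul hg', fun z hz ↦ ?_,
    fun z hz ↦ ?_⟩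
  · simp only [← hfg z hz, ← hfg' z hz]
    ring
  · simp only [norm_mul, hn z hz, hn' z hz]

lemma splitsEvenly_const (c : ℂ) : SplitsEvenly (fun _ ↦ c) := by
  obtain ⟨d, hd⟩ := IsAlgClosed.exists_pow_nat_eq c zero_lt_two
  exact ⟨fun _ ↦ d, fun _ ↦ d, diffContOnCl_const, diffContOnCl_const,
    fun _ _ ↦ by rw [← sq, hd], fun _ _ ↦ rfl⟩

lemma exists_sqrt_one_sub_mul {c : ℂ} (hc : ‖c‖ ≤ 1) :
    ∃ s : ℂ → ℂ, DiffContOnCl ℂ s (ball 0 1) ∧ ∀ z, s z * s z = 1 - c * z := by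
  have hre : ∀ z : ℂ, (1 - c * z).re = 1 - (c * z).re := fun z ↦ by simp
  have hle : ∀ z : ℂ, (c * z).re ≤ ‖z‖ := fun z ↦
    (Complex.re_le_norm _).trans (by rw [norm_mul]; exact mul_le_of_le_one_left (norm_nonneg z) hc)
  refine ⟨fun z ↦ (1 - c * z) ^ (1 / 2 : ℂ), ⟨fun z hz ↦ ?_, ?_⟩, fun z ↦ ?_⟩
  · have : 1 - c * z ∈ Complex.slitPlane := by
      refine Or.inl ?_
      have := hle z
      have : ‖z‖ < 1 := by simpa using hz
      rw [hre]
      linarith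
    have hd : DifferentiableAt ℂ (fun z ↦ 1 - c * z) z := by fun_prop
    exact (hd.cpow (differentiableAt_const _) this).differentiableWithinAt
  · rw [closure_ball _ one_ne_zero]
    intro z hz
    refine ContinuousAt.continuousWithinAt ?_
    have h0 : 0 ≤ (1 - c * z).re := by
      have := hle z
      have : ‖z‖ ≤ 1 := by simpa using hz
      rw [hre]
      linarith
    have hc : ContinuousAt (fun z ↦ 1 - c * z) z := by fun_prop
    exact (Complex.continuousAt_cpow_const_of_re_pos (w := (1 / 2 : ℂ)) (Or.inl h0)
      (by norm_num)).comp (f := fun z ↦ 1 - c * z) hc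
  · simp [← sq]

lemma splitsEvenly_sub_const (a : ℂ) : SplitsEvenly (fun z ↦ z - a) := by
  rcases lt_or_ge ‖a‖ 1 with ha | ha
  · obtain ⟨s, hs, hss⟩ := exists_sqrt_one_sub_mul (c := conj a) (by simpa using ha.le)
    have hne : ∀ z ∈ closedBall (0 : ℂ) 1, 1 - conj a * z ≠ 0 := by
      intro z hz h0
      have h1 : ‖conj a * z‖ = 1 := by rw [← sub_eq_zero.1 h0, norm_one]
      rw [norm_mul, RCLike.norm_conj] at h1
      have : ‖z‖ ≤ 1 := by simpa using hz
      nlinarith [norm_nonneg a, norm_nonneg z]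
    have hcl : closure (ball (0 : ℂ) 1) = closedBall 0 1 := closure_ball _ one_ne_zero
    have hb : DiffContOnCl ℂ (fun z ↦ (z - a) / (1 - conj a * z)) (ball 0 1) := by
      refine ⟨fun z hz ↦ ?_, fun z hz ↦ ?_⟩
      · have := hne z (ball_subset_closedBall hz)
        fun_prop (disch := assumption)
      · have := hne z (hcl ▸ hz)
        fun_prop (disch := assumption)
    refine ⟨fun z ↦ (z - a) / (1 - conj a * z) * s z, s, hb.smul hs, hs, fun z hz ↦ ?_,
      fun z hz ↦ ?_⟩
    · have := hne z hz
      rw [mul_assoc, hss, div_mul_cancel₀ _ this]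
    · have := hne z (sphere_subset_closedBall hz)
      have hz1 : ‖z‖ = 1 := by simpa using hz
      have hsq : ‖z - a‖ ^ 2 = ‖1 - conj a * z‖ ^ 2 := by
        have hid : ‖1 - conj a * z‖ ^ 2 - ‖z - a‖ ^ 2 = (1 - ‖a‖ ^ 2) * (1 - ‖z‖ ^ 2) := by
          simp only [Complex.sq_norm, Complex.normSq_apply, Complex.sub_re, Complex.sub_im,
            Complex.mul_re, Complex.mul_im, Complex.conj_re, Complex.conj_im, Complex.one_re,
            Complex.one_im]
          ring
        rw [hz1] at hid
        linarith
      have heq : ‖z - a‖ = ‖1 - conj a * z‖ :=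
        (pow_left_inj₀ (norm_nonneg _) (norm_nonneg _) two_ne_zero).1 hsq
      rw [norm_mul, norm_div, heq, div_self (by simpa using this), one_mul]
  · have ha0 : a ≠ 0 := by
      rintro rfl
      norm_num at ha
    obtain ⟨s, hs, hss⟩ := exists_sqrt_one_sub_mul (c := a⁻¹)
      (by rw [norm_inv]; exact inv_le_one_of_one_le₀ ha)
    have h1 : SplitsEvenly (fun z ↦ 1 - a⁻¹ * z) :=
      ⟨s, s, hs, hs, fun z _ ↦ hss z, fun _ _ ↦ rfl⟩
    convert (splitsEvenly_const (-a)).mul h1 using 2 with z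
    field_simp
    ring

lemma splitsEvenly_eval (p : ℂ[X]) : SplitsEvenly (fun z ↦ p.eval z) := by
  have hroots : ∀ m : Multiset ℂ,
      SplitsEvenly (fun z ↦ (m.map fun a ↦ (X - C a : ℂ[X])).prod.eval z) := by
    intro m
    induction m using Multiset.induction_on with
    | empty => simpa using splitsEvenly_const 1
    | cons a m ih => simpa using (splitsEvenly_sub_const a).mul ih
  have hp := (IsAlgClosed.splits p).eq_prod_roots
  convert (splitsEvenly_const p.leadingCoeff).mul (hroots p.roots) using 2 with z
  conv_lhs => rw [hp]
  rw [eval_mul, eval_C]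

lemma DifferentiableOn.exists_polynomial_approx {f : ℂ → ℂ}
    (hf : DifferentiableOn ℂ f (ball 0 1)) {t ε : ℝ} (ht0 : 0 ≤ t) (ht1 : t < 1) (hε : 0 < ε) :
    ∃ p : ℂ[X], ∀ z ∈ closedBall (0 : ℂ) t, ‖p.eval z - f z‖ < ε := by
  obtain ⟨r, htr, hr1⟩ := exists_between ht1
  obtain ⟨R, hrR, hR1⟩ := exists_between hr1
  lift r to NNReal using by linarith
  lift R to NNReal using by linarith [r.2]
  have hps := (hf.mono (closedBall_subset_ball hR1)).hasFPowerSeriesOnBall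
    (r.2.trans_lt hrR)
  have hu := hps.tendstoUniformlyOn (r' := r) (by exact_mod_cast hrR)
  obtain ⟨N, hN⟩ := (Metric.tendstoUniformlyOn_iff.1 hu ε hε).exists
  refine ⟨∑ k ∈ Finset.range N, C ((cauchyPowerSeries f 0 R).coeff k) * X ^ k, fun z hz ↦ ?_⟩
  have := hN z (closedBall_subset_ball htr hz)
  rw [dist_comm, dist_eq_norm] at this
  rw [zero_add, FormalMultilinearSeries.partialSum] at this
  simpa only [eval_finsetSum, eval_mul, eval_C, eval_pow, eval_X, mul_comm,
    FormalMultilinearSeries.apply_eq_pow_smul_coeff, smul_eq_mul] using this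

lemma exists_ultrafilter_limit {F : ℕ → ℂ → ℂ}
    (hF : ∀ n, DifferentiableOn ℂ (F n) (ball 0 1))
    (hb : ∀ n, ∀ z ∈ ball (0 : ℂ) 1, ‖F n z‖ ≤ 1) (φ : Ultrafilter ℕ) :
    ∃ g : ℂ → ℂ, DifferentiableOn ℂ g (ball 0 1) ∧
      ∀ z ∈ ball (0 : ℂ) 1, Tendsto (fun n ↦ F n z) φ (𝓝 (g z)) := by
  have hlim : ∀ z : ℂ, ∃ w : ℂ, z ∈ ball (0 : ℂ) 1 → Tendsto (fun n ↦ F n z) φ (𝓝 w) := by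
    intro z
    by_cases hz : z ∈ ball (0 : ℂ) 1
    · have hmem : closedBall (0 : ℂ) 1 ∈ φ.map (fun n ↦ F n z) :=
        Ultrafilter.mem_map.2 (univ_mem' fun n ↦ by simpa using hb n z hz)
      obtain ⟨w, -, hw⟩ := (isCompact_closedBall (0 : ℂ) 1).ultrafilter_le_nhds' _ hmem
      exact ⟨w, fun _ ↦ hw⟩
    · exact ⟨0, fun h ↦ absurd h hz⟩
  choose g hg using hlim
  refine ⟨g, TendstoLocallyUniformlyOn.differentiableOn (F := F) (φ := φ) ?_
    (Eventually.of_forall hF) isOpen_ball, hg⟩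
  rw [Metric.tendstoLocallyUniformlyOn_iff]
  intro ε hε c hc
  obtain ⟨ρ, hρ, hball⟩ := Metric.isOpen_ball.mem_nhds hc |> Metric.mem_nhds_iff.1
  have hlip : ∀ n, ∀ y ∈ ball c ρ, dist (F n y) (F n c) ≤ 3 / ρ * dist y c := by
    intro n y hy
    refine Complex.dist_le_div_mul_dist_of_mapsTo_ball ((hF n).mono hball) (fun w hw ↦ ?_) hy
    have h1 := hb n w (hball hw)
    have h2 := hb n c hc
    have := norm_sub_le (F n w) (F n c)
    rw [mem_closedBall, dist_eq_norm]
    linarith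
  have hglip : ∀ y ∈ ball c ρ, dist (g y) (g c) ≤ 3 / ρ * dist y c := fun y hy ↦
    le_of_tendsto ((hg y (hball hy)).dist (hg c hc)) (Eventually.of_forall fun n ↦ hlip n y hy)
  have hδ : 0 < min ρ (ρ * ε / 12) := by positivity
  refine ⟨ball c (min ρ (ρ * ε / 12)), mem_nhdsWithin_of_mem_nhds (ball_mem_nhds c hδ), ?_⟩
  filter_upwards [Metric.tendsto_nhds.1 (hg c hc) (ε / 4) (by positivity)] with n hn y hy
  have hyρ : y ∈ ball c ρ := ball_subset_ball (min_le_left _ _) hy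
  have hyd : 3 / ρ * dist y c ≤ ε / 4 := by
    have : dist y c ≤ ρ * ε / 12 := (mem_ball.1 hy).le.trans (min_le_right _ _)
    calc 3 / ρ * dist y c ≤ 3 / ρ * (ρ * ε / 12) := by gcongr
      _ = ε / 4 := by field_simp; norm_num
  have h1 := hglip y hyρ
  have h2 := hlip n y hyρ
  rw [dist_comm] at hn h2
  have := dist_triangle4 (g y) (g c) (F n c) (F n y)
  linarith

lemma IsContraction2.norm_entries_le {a b c d : ℂ} (h : IsContraction2 a b c d) :
    ‖a‖ ≤ 1 ∧ ‖b‖ ≤ 1 ∧ ‖c‖ ≤ 1 ∧ ‖d‖ ≤ 1 := by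
  have h1 := h 1 0
  have h2 := h 0 1
  simp only [mul_one, mul_zero, add_zero, zero_add, norm_one, norm_zero] at h1 h2
  refine ⟨?_, ?_, ?_, ?_⟩ <;> rw [← sq_le_one_iff₀ (norm_nonneg _)] <;>
    nlinarith [sq_nonneg ‖a‖, sq_nonneg ‖b‖, sq_nonneg ‖c‖, sq_nonneg ‖d‖]

/-- The maximum principle for matrix-valued functions. -/
lemma isContraction2_of_sphere {a b c d : ℂ → ℂ} (ha : DiffContOnCl ℂ a (ball 0 1))
    (hb : DiffContOnCl ℂ b (ball 0 1)) (hc : DiffContOnCl ℂ c (ball 0 1))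
    (hd : DiffContOnCl ℂ d (ball 0 1))
    (h : ∀ z ∈ sphere (0 : ℂ) 1, IsContraction2 (a z) (b z) (c z) (d z)) :
    ∀ z ∈ ball (0 : ℂ) 1, IsContraction2 (a z) (b z) (c z) (d z) := by
  intro z hz u v
  have hG : DiffContOnCl ℂ
      (fun z ↦ (a z) • !₂[u, 0] + (b z) • !₂[v, 0] + (c z) • !₂[0, u] + (d z) • !₂[0, v])
      (ball 0 1) :=
    (((ha.smul_const _).add (hb.smul_const _)).add (hc.smul_const _)).add (hd.smul_const _)
  have key := Complex.norm_le_of_forall_mem_frontier_norm_le (C := ‖!₂[u, v]‖) isBounded_ball hG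
    (fun ζ hζ ↦ ?_) (subset_closure hz)
  · have := pow_le_pow_left₀ (norm_nonneg _) key 2
    simpa [EuclideanSpace.norm_sq_eq] using this
  · rw [frontier_ball _ one_ne_zero] at hζ
    refine (abs_le_of_sq_le_sq' ?_ (norm_nonneg _)).2
    simpa [EuclideanSpace.norm_sq_eq] using h ζ hζ u v

lemma exists_contraction_of_polynomials {p₁ p₂ p₃ : ℂ[X]}
    (h : ∀ z ∈ sphere (0 : ℂ) 1, TetraIneq (p₁.eval z) (p₂.eval z) (p₃.eval z)) :
    ∃ b c : ℂ → ℂ, DifferentiableOn ℂ b (ball 0 1) ∧ DifferentiableOn ℂ c (ball 0 1) ∧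
      (∀ z ∈ ball (0 : ℂ) 1, b z * c z = p₁.eval z * p₂.eval z - p₃.eval z) ∧
      ∀ z ∈ ball (0 : ℂ) 1, IsContraction2 (p₁.eval z) (b z) (c z) (p₂.eval z) := by
  obtain ⟨b, c, hb, hc, hbc, hn⟩ := splitsEvenly_eval (p₁ * p₂ - p₃)
  simp only [eval_sub, eval_mul] at hbc
  refine ⟨b, c, hb.1, hc.1, fun z hz ↦ hbc z (ball_subset_closedBall hz),
    isContraction2_of_sphere p₁.differentiable.diffContOnCl hb hc p₂.differentiable.diffContOnCl
      fun z hz ↦ ?_⟩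
  obtain ⟨h3, hle⟩ := h z hz
  have hz' := hbc z (sphere_subset_closedBall hz)
  have hdet : p₁.eval z * p₂.eval z - b z * c z = p₃.eval z := by
    rw [hz']
    ring
  have hprod : ‖c z‖ * ‖c z‖ = ‖p₁.eval z * p₂.eval z - p₃.eval z‖ := by
    rw [← hz', norm_mul, hn z hz]
  refine isContraction2_of_trace_det (by rwa [hdet]) ?_
  rw [hdet, hn z hz]
  linarith

lemma exists_polynomials_approx {x₁ x₂ x₃ : ℂ → ℂ} (h₁ : DifferentiableOn ℂ x₁ (ball 0 1))
    (h₂ : DifferentiableOn ℂ x₂ (ball 0 1)) (h₃ : DifferentiableOn ℂ x₃ (ball 0 1))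
    (hx : ∀ z ∈ ball (0 : ℂ) 1, TetraIneq (x₁ z) (x₂ z) (x₃ z)) {t ε : ℝ} (ht0 : 0 ≤ t)
    (ht1 : t < 1) (hε : 0 < ε) :
    ∃ p₁ p₂ p₃ : ℂ[X], ∀ z ∈ closedBall (0 : ℂ) 1,
      TetraIneq (p₁.eval z) (p₂.eval z) (p₃.eval z) ∧
      dist (p₁.eval z) (t * x₁ (t * z)) < ε ∧ dist (p₂.eval z) (t * x₂ (t * z)) < ε ∧
      dist (p₃.eval z) (t ^ 2 * x₃ (t * z)) < ε := by
  let U : Set (ℂ × ℂ × ℂ) := {y | ‖y.2.2‖ < 1} ∩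
    {y | ‖y.1‖ ^ 2 + ‖y.2.1‖ ^ 2 + 2 * ‖y.1 * y.2.1 - y.2.2‖ < 1 + ‖y.2.2‖ ^ 2}
  have hU : IsOpen U :=
    (isOpen_lt (by fun_prop) (by fun_prop)).inter (isOpen_lt (by fun_prop) (by fun_prop))
  have hmaps : ∀ z ∈ closedBall (0 : ℂ) 1, (t * z : ℂ) ∈ closedBall (0 : ℂ) t := by
    intro z hz
    have : ‖z‖ ≤ 1 := by simpa using hz
    simpa [abs_of_nonneg ht0] using mul_le_of_le_one_right ht0 this
  have hmaps' : Set.MapsTo (fun z : ℂ ↦ (t * z : ℂ)) (closedBall 0 1) (ball 0 1) :=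
    fun z hz ↦ closedBall_subset_ball ht1 (hmaps z hz)
  let Y : ℂ → ℂ × ℂ × ℂ := fun z ↦ (t * x₁ (t * z), t * x₂ (t * z), t ^ 2 * x₃ (t * z))
  have hlin : ContinuousOn (fun z : ℂ ↦ (t * z : ℂ)) (closedBall 0 1) := by fun_prop
  have hY : ContinuousOn Y (closedBall 0 1) :=
    (continuousOn_const.mul (h₁.continuousOn.comp hlin hmaps')).prodMk
      ((continuousOn_const.mul (h₂.continuousOn.comp hlin hmaps')).prodMk
        (continuousOn_const.mul (h₃.continuousOn.comp hlin hmaps')))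
  have hYU : Y '' closedBall 0 1 ⊆ U := by
    rintro _ ⟨z, hz, rfl⟩
    exact (hx _ (hmaps' hz)).dilate ht0 ht1
  obtain ⟨δ, hδ, hthick⟩ :=
    ((isCompact_closedBall (0 : ℂ) 1).image_of_continuousOn hY).exists_thickening_subset_open hU hYU
  have hη : 0 < min ε δ := lt_min hε hδ
  obtain ⟨q₁, hq₁⟩ := h₁.exists_polynomial_approx ht0 ht1 hη
  obtain ⟨q₂, hq₂⟩ := h₂.exists_polynomial_approx ht0 ht1 hη
  obtain ⟨q₃, hq₃⟩ := h₃.exists_polynomial_approx ht0 ht1 hη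
  have hscale : ∀ (s : ℝ) (a b : ℂ), 0 ≤ s → s ≤ 1 → ‖a - b‖ < min ε δ →
      dist ((s : ℂ) * a) (s * b) < min ε δ := by
    intro s a b hs0 hs1 hab
    rw [dist_eq_norm, ← mul_sub, norm_mul, Complex.norm_real, Real.norm_of_nonneg hs0]
    exact (mul_le_of_le_one_left (norm_nonneg _) hs1).trans_lt hab
  refine ⟨C (t : ℂ) * q₁.comp (C (t : ℂ) * X), C (t : ℂ) * q₂.comp (C (t : ℂ) * X),
    C ((t ^ 2 : ℝ) : ℂ) * q₃.comp (C (t : ℂ) * X), fun z hz ↦ ?_⟩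
  have e₁ := hscale t _ _ ht0 ht1.le (hq₁ _ (hmaps z hz))
  have e₂ := hscale t _ _ ht0 ht1.le (hq₂ _ (hmaps z hz))
  have e₃ := hscale (t ^ 2) _ _ (sq_nonneg t) (pow_le_one₀ ht0 ht1.le) (hq₃ _ (hmaps z hz))
  simp only [eval_mul, eval_C, eval_comp, eval_X]
  push_cast at e₃ ⊢
  have hmem := hthick (mem_thickening_iff.2 ⟨Y z, Set.mem_image_of_mem Y hz,
    show dist ((t : ℂ) * q₁.eval (t * z : ℂ), (t : ℂ) * q₂.eval (t * z : ℂ),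
      (t : ℂ) ^ 2 * q₃.eval (t * z : ℂ)) (Y z) < δ by
    simp only [Y, Prod.dist_eq]
    exact max_lt (e₁.trans_le (min_le_right _ _)) (max_lt (e₂.trans_le (min_le_right _ _))
      (e₃.trans_le (min_le_right _ _)))⟩)
  exact ⟨⟨hmem.1.le, hmem.2.le⟩, e₁.trans_le (min_le_left _ _), e₂.trans_le (min_le_left _ _),
    e₃.trans_le (min_le_left _ _)⟩

/-- Every analytic map of the disc into the closed tetrablock lifts to a contractive analytic
matrix function. -/
theorem exists_contraction_lift {x₁ x₂ x₃ : ℂ → ℂ} (h₁ : DifferentiableOn ℂ x₁ (ball 0 1))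
    (h₂ : DifferentiableOn ℂ x₂ (ball 0 1)) (h₃ : DifferentiableOn ℂ x₃ (ball 0 1))
    (hx : ∀ z ∈ ball (0 : ℂ) 1, TetraIneq (x₁ z) (x₂ z) (x₃ z)) :
    ∃ b c : ℂ → ℂ, DifferentiableOn ℂ b (ball 0 1) ∧ DifferentiableOn ℂ c (ball 0 1) ∧
      (∀ z ∈ ball (0 : ℂ) 1, b z * c z = x₁ z * x₂ z - x₃ z) ∧
      ∀ z ∈ ball (0 : ℂ) 1, IsContraction2 (x₁ z) (b z) (c z) (x₂ z) := by
  let ε : ℕ → ℝ := fun n ↦ 1 / ((n : ℝ) + 1)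
  have hε0 : ∀ n, 0 < ε n := fun n ↦ by positivity
  have hε1 : ∀ n, ε n ≤ 1 := fun n ↦ by
    rw [div_le_one (by positivity)]
    linarith [Nat.cast_nonneg (α := ℝ) n]
  have hεlim : Tendsto ε atTop (𝓝 0) := tendsto_one_div_add_atTop_nhds_zero_nat
  choose p₁ p₂ p₃ hp using fun n ↦ exists_polynomials_approx h₁ h₂ h₃ hx (t := 1 - ε n)
    (sub_nonneg.2 (hε1 n)) (sub_lt_self _ (hε0 n)) (hε0 n)
  choose b c hb hc hbc hcontr using fun n ↦ exists_contraction_of_polynomials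
    fun z hz ↦ (hp n z (sphere_subset_closedBall hz)).1
  have hφ : (hyperfilter ℕ : Filter ℕ) ≤ atTop := Nat.hyperfilter_le_atTop
  obtain ⟨b', hb', hblim⟩ := exists_ultrafilter_limit hb
    (fun n z hz ↦ (hcontr n z hz).norm_entries_le.2.1) (hyperfilter ℕ)
  obtain ⟨c', hc', hclim⟩ := exists_ultrafilter_limit hc
    (fun n z hz ↦ (hcontr n z hz).norm_entries_le.2.2.1) (hyperfilter ℕ)
  have ht : Tendsto (fun n ↦ ((1 - ε n : ℝ) : ℂ)) atTop (𝓝 1) := by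
    have := (Complex.continuous_ofReal.tendsto _).comp (hεlim.const_sub 1)
    simpa [Function.comp_def] using this
  have hcomp : ∀ {f : ℂ → ℂ}, DifferentiableOn ℂ f (ball 0 1) → ∀ z ∈ ball (0 : ℂ) 1,
      Tendsto (fun n ↦ f (((1 - ε n : ℝ) : ℂ) * z)) atTop (𝓝 (f z)) := by
    intro f hf z hz
    have h1 : ContinuousAt f z := hf.continuousOn.continuousAt (isOpen_ball.mem_nhds hz)
    exact h1.tendsto.comp (by simpa using ht.mul_const z)
  have happrox : ∀ {u v : ℕ → ℂ} {w : ℂ}, (∀ n, dist (u n) (v n) < ε n) →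
      Tendsto v atTop (𝓝 w) → Tendsto u (hyperfilter ℕ : Filter ℕ) (𝓝 w) := by
    intro u v w huv hv
    refine Tendsto.mono_left (hv.congr_dist ?_) hφ
    exact squeeze_zero (fun _ ↦ dist_nonneg) (fun n ↦ by rw [dist_comm]; exact (huv n).le) hεlim
  have lim₁ : ∀ z ∈ ball (0 : ℂ) 1,
      Tendsto (fun n ↦ (p₁ n).eval z) (hyperfilter ℕ : Filter ℕ) (𝓝 (x₁ z)) := fun z hz ↦
    happrox (fun n ↦ (hp n z (ball_subset_closedBall hz)).2.1)
      (by simpa using ht.mul (hcomp h₁ z hz))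
  have lim₂ : ∀ z ∈ ball (0 : ℂ) 1,
      Tendsto (fun n ↦ (p₂ n).eval z) (hyperfilter ℕ : Filter ℕ) (𝓝 (x₂ z)) := fun z hz ↦
    happrox (fun n ↦ (hp n z (ball_subset_closedBall hz)).2.2.1)
      (by simpa using ht.mul (hcomp h₂ z hz))
  have lim₃ : ∀ z ∈ ball (0 : ℂ) 1,
      Tendsto (fun n ↦ (p₃ n).eval z) (hyperfilter ℕ : Filter ℕ) (𝓝 (x₃ z)) := fun z hz ↦
    happrox (fun n ↦ (hp n z (ball_subset_closedBall hz)).2.2.2)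
      (by simpa using (ht.pow 2).mul (hcomp h₃ z hz))
  refine ⟨b', c', hb', hc', fun z hz ↦ ?_, fun z hz u v ↦ ?_⟩
  · refine tendsto_nhds_unique ((hblim z hz).mul (hclim z hz)) ?_
    simpa only [hbc _ z hz] using ((lim₁ z hz).mul (lim₂ z hz)).sub (lim₃ z hz)
  · refine le_of_tendsto (x := (hyperfilter ℕ : Filter ℕ))
      (((((lim₁ z hz).mul_const u).add ((hblim z hz).mul_const v)).norm.pow 2).add
        ((((hclim z hz).mul_const u).add ((lim₂ z hz).mul_const v)).norm.pow 2))
      (Eventually.of_forall fun n ↦ hcontr n z hz u v)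

theorem stmt_0 (n : ℕ) (lam : Fin n → ℂ) (hlam : ∀ k, lam k ∈ Metric.ball (0:ℂ) 1)
    (hinj : Function.Injective lam) (x₁ x₂ x₃ : Fin n → ℂ)
    (hx : ∀ k, (x₁ k, x₂ k, x₃ k) ∈ openTetra) :
    (∃ x : ℂ → ℂ × ℂ × ℂ,
        DifferentiableOn ℂ x (Metric.ball (0:ℂ) 1) ∧
        (∀ z ∈ Metric.ball (0:ℂ) 1, x z ∈ closedTetra) ∧
        ∀ k, x (lam k) = (x₁ k, x₂ k, x₃ k)) ↔
    (∃ b c : Fin n → ℂ,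
        (∀ k, b k * c k = x₁ k * x₂ k - x₃ k) ∧
        ∃ F : ℂ → Matrix (Fin 2) (Fin 2) ℂ,
          (∀ i j, DifferentiableOn ℂ (fun z => F z i j) (Metric.ball (0:ℂ) 1)) ∧
          (∀ z ∈ Metric.ball (0:ℂ) 1, opNorm2 (F z) ≤ 1) ∧
          ∀ k, F (lam k) = !![x₁ k, b k; c k, x₂ k]) := by
  constructor
  · rintro ⟨x, hx, hxE, hxlam⟩
    obtain ⟨b, c, hb, hc, hbc, hF⟩ := exists_contraction_lift hx.fst hx.snd.fst hx.snd.snd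
      fun z hz ↦ tetraIneq_of_pencil fun w hw w' hw' ↦
        hxE z hz w (by simpa using hw) w' (by simpa using hw')
    refine ⟨fun k ↦ b (lam k), fun k ↦ c (lam k), fun k ↦ by simp [hbc _ (hlam k), hxlam],
      fun z ↦ !![(x z).1, b z; c z, (x z).2.1], fun i j ↦ ?_,
      fun z hz ↦ opNorm2_le_one_iff.2 (hF z hz), fun k ↦ by simp [hxlam]⟩
    fin_cases i <;> fin_cases j
    exacts [hx.fst, hb, hc, hx.snd.fst]
  · rintro ⟨b, c, hbc, F, hF, hnorm, hFlam⟩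
    refine ⟨fun z ↦ (F z 0 0, F z 1 1, F z 0 0 * F z 1 1 - F z 0 1 * F z 1 0),
      (hF 0 0).prodMk ((hF 1 1).prodMk (((hF 0 0).mul (hF 1 1)).sub ((hF 0 1).mul (hF 1 0)))),
      fun z hz w hw w' hw' ↦ ?_, fun k ↦ ?_⟩
    · have h := hnorm z hz
      rw [Matrix.eta_fin_two (F z), opNorm2_le_one_iff] at h
      exact h.pencil_ne_zero (by simpa using hw) (by simpa using hw')
    · simp [hFlam, hbc]
end

section
/- Let λ₁,…,λₙ be distinct points in the open unit disc 𝔻 and let (x₁ᵏ,x₂ᵏ,x₃ᵏ) ∈ E with x₁ᵏx₂ᵏ ≠ x₃ᵏ for k = 1,…,n. Then the following are equivalent: (1) there exists an analytic map x : 𝔻 → ℂ³ with x(𝔻) ⊆ Ē and x(λₖ) = (x₁ᵏ,x₂ᵏ,x₃ᵏ) for k = 1,…,n; (2) there exist complex numbers b₁,…,bₙ and c₁,…,cₙ with bₖcₖ = x₁ᵏx₂ᵏ − x₃ᵏ for k = 1,…,n such that the 2n×2n block matrix whose (k,ℓ) block (of size 2×2) is (I − Wₖ* W_ℓ)/(1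 − conj(λₖ)λ_ℓ), where Wₖ = [[x₁ᵏ, bₖ],[cₖ, x₂ᵏ]], is positive semidefinite. -/
open scoped Matrix ComplexOrder

lemma norm_sub_mul_le_of_mem_closedTetra {x : ℂ × ℂ × ℂ} (hx : x ∈ closedTetra) {z : ℂ}
    (hz : ‖z‖ ≤ 1) : ‖x.2.1 - x.2.2 * z‖ ≤ ‖1 - x.1 * z‖ := by
  have hball : ∀ z ∈ Metric.ball (0 : ℂ) 1, ‖x.2.1 - x.2.2 * z‖ ≤ ‖1 - x.1 * z‖ := by
    intro z hz
    by_contra! hlt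
    have hpos : 0 < ‖x.2.1 - x.2.2 * z‖ := (norm_nonneg _).trans_lt hlt
    refine hx z hz ((1 - x.1 * z) / (x.2.1 - x.2.2 * z)) ?_ ?_
    · rwa [mem_ball_zero_iff, norm_div, div_lt_one hpos]
    · linear_combination -div_mul_cancel₀ (1 - x.1 * z) (norm_pos_iff.1 hpos)
  refine le_on_closure hball (by fun_prop) (by fun_prop) ?_
  rwa [closure_ball _ one_ne_zero, mem_closedBall_zero_iff]

lemma swap_mem_closedTetra {x : ℂ × ℂ × ℂ} (hx : x ∈ closedTetra) :
    (x.2.1, x.1, x.2.2) ∈ closedTetra := by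
  intro z hz w hw h
  refine hx w hw z hz ?_
  rw [← h]
  ring

lemma exists_norm_eq_one_mul_eq_norm (a : ℂ) : ∃ z : ℂ, ‖z‖ = 1 ∧ a * z = ‖a‖ := by
  rcases eq_or_ne a 0 with rfl | ha
  · exact ⟨1, by simp⟩
  · have ha' : (‖a‖ : ℂ) ≠ 0 := by simpa using ha
    refine ⟨(starRingEnd ℂ) a / ‖a‖, by simp [ha], ?_⟩
    rw [mul_div_assoc', Complex.mul_conj', sq, mul_div_assoc, div_self ha', mul_one]

lemma two_mul_norm_sub_le_of_mem_closedTetra {x : ℂ × ℂ × ℂ} (hx : x ∈ closedTetra) :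
    2 * ‖x.1 - (starRingEnd ℂ) x.2.1 * x.2.2‖ ≤
      1 + ‖x.1‖ ^ 2 - ‖x.2.1‖ ^ 2 - ‖x.2.2‖ ^ 2 := by
  obtain ⟨z, hz, hmul⟩ := exists_norm_eq_one_mul_eq_norm (x.1 - (starRingEnd ℂ) x.2.1 * x.2.2)
  have h := pow_le_pow_left₀ (norm_nonneg _)
    (norm_sub_mul_le_of_mem_closedTetra hx hz.le) 2
  have hre := congrArg Complex.re hmul
  rw [Complex.ofReal_re] at hre
  simp only [← Complex.normSq_eq_norm_sq, Complex.normSq_sub, map_mul, map_one] at h ⊢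
  have hz' : Complex.normSq z = 1 := by rw [Complex.normSq_eq_norm_sq, hz, one_pow]
  rw [hz'] at h
  simp only [Complex.mul_re, Complex.mul_im, Complex.sub_re, Complex.sub_im, Complex.conj_re,
    Complex.conj_im, Complex.one_re, Complex.one_im] at h hre
  linarith

/-- The inequalities that make the closed tetrablock a projection of the unit ball of matrices. -/
lemma norm_bounds_of_mem_closedTetra {x : ℂ × ℂ × ℂ} (hx : x ∈ closedTetra) :
    ‖x.2.2‖ ≤ 1 ∧
      ‖x.1‖ ^ 2 + ‖x.2.1‖ ^ 2 + 2 * ‖x.1 * x.2.1 - x.2.2‖ ≤ 1 + ‖x.2.2‖ ^ 2 := by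
  have h₁ := two_mul_norm_sub_le_of_mem_closedTetra hx
  have h₂ := two_mul_norm_sub_le_of_mem_closedTetra (swap_mem_closedTetra hx)
  simp only at h₂
  have hx₂ : ‖x.2.1‖ ≤ 1 := by
    simpa using norm_sub_mul_le_of_mem_closedTetra hx (z := 0) (by simp)
  have hx₁ : ‖x.1‖ ≤ 1 := by
    simpa using norm_sub_mul_le_of_mem_closedTetra (swap_mem_closedTetra hx) (z := 0) (by simp)
  have hx₃ : ‖x.2.2‖ ≤ 1 := by
    have := norm_nonneg (x.1 - (starRingEnd ℂ) x.2.1 * x.2.2)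
    have := norm_nonneg (x.2.1 - (starRingEnd ℂ) x.1 * x.2.2)
    nlinarith [norm_nonneg x.2.2]
  refine ⟨hx₃, ?_⟩
  have htri : ‖x.2.1‖ + ‖x.1‖ ≤ 1 + ‖x.2.2‖ := by
    obtain ⟨z, hz, hmul⟩ := exists_norm_eq_one_mul_eq_norm x.1
    have h := norm_sub_mul_le_of_mem_closedTetra hx hz.le
    have h' : ‖1 - x.1 * z‖ = 1 - ‖x.1‖ := by
      rw [hmul, ← Complex.ofReal_one, ← Complex.ofReal_sub, Complex.norm_real,
        Real.norm_of_nonneg (by linarith)]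
    have h'' := norm_sub_norm_le x.2.1 (x.2.2 * z)
    rw [norm_mul, hz, mul_one] at h''
    linarith
  have hsum : ‖x.1‖ ^ 2 + ‖x.2.1‖ ^ 2 ≤ 1 + ‖x.2.2‖ ^ 2 := by
    rcases le_total 1 (‖x.2.1‖ + ‖x.1‖) with h | h
    · nlinarith [norm_nonneg x.1, norm_nonneg x.2.1, norm_nonneg x.2.2]
    · nlinarith [norm_nonneg x.1, norm_nonneg x.2.1, norm_nonneg x.2.2]
  have hid : ‖x.1 * x.2.1 - x.2.2‖ ^ 2 = ‖x.1 - (starRingEnd ℂ) x.2.1 * x.2.2‖ ^ 2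
      - (‖x.1‖ ^ 2 - ‖x.2.2‖ ^ 2) * (1 - ‖x.2.1‖ ^ 2) := by
    simp only [← Complex.normSq_eq_norm_sq, Complex.normSq_apply, Complex.sub_re, Complex.sub_im,
      Complex.mul_re, Complex.mul_im, Complex.conj_re, Complex.conj_im]
    ring
  have hsq : (2 * ‖x.1 - (starRingEnd ℂ) x.2.1 * x.2.2‖) ^ 2 ≤
      (1 + ‖x.1‖ ^ 2 - ‖x.2.1‖ ^ 2 - ‖x.2.2‖ ^ 2) ^ 2 :=
    pow_le_pow_left₀ (by positivity) h₁ 2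
  have := abs_le_of_sq_le_sq' (a := 2 * ‖x.1 * x.2.1 - x.2.2‖)
    (b := 1 + ‖x.2.2‖ ^ 2 - ‖x.1‖ ^ 2 - ‖x.2.1‖ ^ 2) (by nlinarith) (by linarith)
  linarith [this.2]

lemma dotProduct_one_sub_conjTranspose_mul_mulVec {m n : Type*} [Fintype m] [Fintype n]
    [DecidableEq n] (A : Matrix m n ℂ) (v : n → ℂ) :
    star v ⬝ᵥ ((1 - Aᴴ * A) *ᵥ v) = star v ⬝ᵥ v - star (A *ᵥ v) ⬝ᵥ (A *ᵥ v) := by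
  rw [Matrix.sub_mulVec, dotProduct_sub, Matrix.one_mulVec, ← Matrix.mulVec_mulVec,
    Matrix.dotProduct_mulVec, Matrix.star_mulVec]

lemma star_dotProduct_self_eq_sum {ι : Type*} [Fintype ι] (u : ι → ℂ) :
    star u ⬝ᵥ u = ((∑ i, ‖u i‖ ^ 2 : ℝ) : ℂ) := by
  simp [dotProduct, Complex.conj_mul']

lemma posSemidef_one_sub_conjTranspose_mul_self_iff {m n : Type*} [Fintype m] [Fintype n]
    [DecidableEq n] (A : Matrix m n ℂ) :
    (1 - Aᴴ * A).PosSemidef ↔ ∀ v, ∑ i, ‖(A *ᵥ v) i‖ ^ 2 ≤ ∑ j, ‖v j‖ ^ 2 := by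
  have hH : (1 - Aᴴ * A).IsHermitian :=
    Matrix.isHermitian_one.sub (Matrix.isHermitian_conjTranspose_mul_self A)
  rw [Matrix.posSemidef_iff_dotProduct_mulVec, and_iff_right hH]
  refine forall_congr' fun v => ?_
  rw [dotProduct_one_sub_conjTranspose_mul_mulVec, sub_nonneg, star_dotProduct_self_eq_sum,
    star_dotProduct_self_eq_sum, Complex.real_le_real]

lemma two_mul_mul_mul_le_of_sq_le_mul {a b c x y : ℝ} (ha : 0 ≤ a) (hc : 0 ≤ c)
    (hb : b ^ 2 ≤ a * c) : 2 * x * y * b ≤ a * x ^ 2 + c * y ^ 2 := by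
  rcases (add_nonneg ha hc).eq_or_lt with h | h
  · have ha0 : a = 0 := by linarith
    have hc0 : c = 0 := by linarith
    have hb0 : b = 0 := by
      subst ha0
      nlinarith
    simp [ha0, hc0, hb0]
  · have h₁ : 0 ≤ (a + c) * (a * x ^ 2 + c * y ^ 2 - 2 * x * y * b) := by
      nlinarith [sq_nonneg (a * x - b * y), sq_nonneg (c * y - b * x),
        mul_nonneg (sub_nonneg.2 hb) (sq_nonneg x), mul_nonneg (sub_nonneg.2 hb) (sq_nonneg y)]
    linarith [nonneg_of_mul_nonneg_right h₁ h]

/-- A two by two matrix is a contraction when its two invariants are suitably bounded. -/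
lemma posSemidef_one_sub_conjTranspose_mul_self_fin_two {p q r s : ℂ}
    (hdet : ‖p * s - q * r‖ ≤ 1)
    (hsum : ‖p‖ ^ 2 + ‖q‖ ^ 2 + ‖r‖ ^ 2 + ‖s‖ ^ 2 ≤ 1 + ‖p * s - q * r‖ ^ 2) :
    (1 - (!![p, q; r, s])ᴴ * !![p, q; r, s]).PosSemidef := by
  rw [posSemidef_one_sub_conjTranspose_mul_self_iff]
  intro v
  simp only [Fin.sum_univ_two, Matrix.mulVec, dotProduct, Matrix.of_apply, Matrix.cons_val_zero,
    Matrix.cons_val_one, Matrix.cons_val', Matrix.cons_val_fin_one]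
  set β := (starRingEnd ℂ) p * q + (starRingEnd ℂ) r * s with hβ
  have hmul : (1 - ‖p‖ ^ 2 - ‖r‖ ^ 2) * (1 - ‖q‖ ^ 2 - ‖s‖ ^ 2) - ‖β‖ ^ 2 =
      1 + ‖p * s - q * r‖ ^ 2 - (‖p‖ ^ 2 + ‖q‖ ^ 2 + ‖r‖ ^ 2 + ‖s‖ ^ 2) := by
    rw [hβ]
    simp only [← Complex.normSq_eq_norm_sq, Complex.normSq_apply, Complex.sub_re, Complex.sub_im,
      Complex.add_re, Complex.add_im, Complex.mul_re, Complex.mul_im, Complex.conj_re,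
      Complex.conj_im]
    ring
  have hdet' : ‖p * s - q * r‖ ^ 2 ≤ 1 := by nlinarith [norm_nonneg (p * s - q * r)]
  have hnn : 0 ≤ 1 - ‖p‖ ^ 2 - ‖r‖ ^ 2 ∧ 0 ≤ 1 - ‖q‖ ^ 2 - ‖s‖ ^ 2 := by
    constructor <;> by_contra! h <;> nlinarith [sq_nonneg ‖β‖]
  have hexp : ‖p * v 0 + q * v 1‖ ^ 2 + ‖r * v 0 + s * v 1‖ ^ 2 =
      (‖p‖ ^ 2 + ‖r‖ ^ 2) * ‖v 0‖ ^ 2 + (‖q‖ ^ 2 + ‖s‖ ^ 2) * ‖v 1‖ ^ 2 +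
        2 * ((starRingEnd ℂ) (v 0) * v 1 * β).re := by
    rw [hβ]
    simp only [← Complex.normSq_eq_norm_sq, Complex.normSq_apply, Complex.add_re, Complex.add_im,
      Complex.mul_re, Complex.mul_im, Complex.conj_re, Complex.conj_im]
    ring
  have hre : ((starRingEnd ℂ) (v 0) * v 1 * β).re ≤ ‖v 0‖ * ‖v 1‖ * ‖β‖ := by
    simpa using Complex.re_le_norm ((starRingEnd ℂ) (v 0) * v 1 * β)
  have := two_mul_mul_mul_le_of_sq_le_mul (x := ‖v 0‖) (y := ‖v 1‖) (b := ‖β‖) hnn.1 hnn.2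
    (by linarith)
  linarith

lemma mem_closedTetra_of_posSemidef {A : Matrix (Fin 2) (Fin 2) ℂ}
    (hA : (1 - Aᴴ * A).PosSemidef) : (A 0 0, A 1 1, A.det) ∈ closedTetra := by
  intro z hz w hw h
  rw [mem_ball_zero_iff] at hz hw
  have hdet : (1 - A * Matrix.diagonal ![z, w]).det = 0 := by
    rw [← h, Matrix.det_fin_two, Matrix.det_fin_two]
    simp [Matrix.mul_diagonal]
    ring
  obtain ⟨v, hv, hv0⟩ := Matrix.exists_mulVec_eq_zero_iff.2 hdet
  rw [Matrix.sub_mulVec, Matrix.one_mulVec, sub_eq_zero, ← Matrix.mulVec_mulVec] at hv0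
  have hle := (posSemidef_one_sub_conjTranspose_mul_self_iff A).1 hA
    (Matrix.diagonal ![z, w] *ᵥ v)
  rw [← hv0] at hle
  simp only [Fin.sum_univ_two, Matrix.mulVec_diagonal, Matrix.cons_val_zero, Matrix.cons_val_one,
    norm_mul, mul_pow] at hle
  have hz2 : ‖z‖ ^ 2 < 1 := by nlinarith [norm_nonneg z]
  have hw2 : ‖w‖ ^ 2 < 1 := by nlinarith [norm_nonneg w]
  have h0 : ‖v 0‖ ^ 2 = 0 := by nlinarith [sq_nonneg ‖v 0‖, sq_nonneg ‖v 1‖]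
  have h1 : ‖v 1‖ ^ 2 = 0 := by nlinarith [sq_nonneg ‖v 0‖, sq_nonneg ‖v 1‖]
  refine hv (funext fun i => ?_)
  fin_cases i
  · exact norm_eq_zero.1 (pow_eq_zero_iff two_ne_zero |>.1 h0)
  · exact norm_eq_zero.1 (pow_eq_zero_iff two_ne_zero |>.1 h1)
lemma Matrix.PosSemidef.exists_eq_conjTranspose_mul_self {κ : Type*} [Finite κ]
    {P : Matrix κ κ ℂ} (hP : P.PosSemidef) :
    ∃ (d : ℕ) (L : Matrix (Fin d) κ ℂ), P = Lᴴ * L := by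
  obtain ⟨d, v, rfl⟩ := Matrix.posSemidef_iff_eq_sum_vecMulVec.1 hP
  refine ⟨d, Matrix.of fun a i => star (v a i), ?_⟩
  ext i j
  simp [Matrix.sum_apply, Matrix.vecMulVec_apply, Matrix.mul_apply]

/-- Two families of vectors with the same Gram matrix differ by an isometry. -/
lemma Matrix.exists_isometry_mul_eq {p κ : Type*} [Fintype p] [DecidableEq p] [Fintype κ]
    [DecidableEq κ] {S T : Matrix p κ ℂ} (h : Sᴴ * S = Tᴴ * T) :
    ∃ U : Matrix p p ℂ, Uᴴ * U = 1 ∧ U * S = T := by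
  have hnorm : ∀ u : EuclideanSpace ℂ κ,
      ‖Matrix.toEuclideanLin T u‖ = ‖Matrix.toEuclideanLin S u‖ := by
    have key : ∀ (M : Matrix p κ ℂ) (u : EuclideanSpace ℂ κ),
        ((‖Matrix.toEuclideanLin M u‖ ^ 2 : ℝ) : ℂ) =
          star u.ofLp ⬝ᵥ ((Mᴴ * M) *ᵥ u.ofLp) := by
      intro M u
      rw [← Matrix.mulVec_mulVec, Matrix.dotProduct_mulVec, ← Matrix.star_mulVec,
        star_dotProduct_self_eq_sum, EuclideanSpace.norm_sq_eq]
      rfl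
    intro u
    have := (key T u).trans ((congrArg (fun M => star u.ofLp ⬝ᵥ (M *ᵥ u.ofLp)) h.symm).trans
      (key S u).symm)
    exact (pow_left_inj₀ (norm_nonneg _) (norm_nonneg _) two_ne_zero).1 (by exact_mod_cast this)
  set f := Matrix.toEuclideanLin S
  set g := Matrix.toEuclideanLin T
  obtain ⟨s, hs⟩ := LinearMap.exists_rightInverse_of_surjective f.rangeRestrict
    f.range_rangeRestrict
  have hs' : ∀ y, f (s y) = y := fun y => congrArg Subtype.val (LinearMap.congr_fun hs y)
  let L : f.range →ₗᵢ[ℂ] EuclideanSpace ℂ p :=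
    { toLinearMap := g ∘ₗ s
      norm_map' := fun y => by
        rw [LinearMap.comp_apply, hnorm, hs', Submodule.coe_norm] }
  have hL : ∀ u, L.extend (f u) = g u := by
    intro u
    have h₁ : L.extend (f u) = g (s (f.rangeRestrict u)) :=
      L.extend_apply (f.rangeRestrict u)
    rw [h₁, ← sub_eq_zero, ← map_sub, ← norm_eq_zero, hnorm, map_sub, hs']
    simp
  set U := Matrix.toEuclideanLin.symm L.extend.toLinearMap with hU
  have hUapp : ∀ v : p → ℂ, U *ᵥ v = (L.extend (WithLp.toLp 2 v)).ofLp := by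
    intro v
    have : Matrix.toEuclideanLin U = L.extend.toLinearMap := by
      rw [hU, LinearEquiv.apply_symm_apply]
    rw [← LinearIsometry.coe_toLinearMap, ← this]
    rfl
  refine ⟨U, ?_, ?_⟩
  · have hcol : ∀ i, WithLp.toLp 2 (U.col i) = L.extend (EuclideanSpace.single i 1) := by
      intro i
      rw [← Matrix.mulVec_single_one, hUapp]
      rfl
    ext i j
    have := L.extend.inner_map_map (EuclideanSpace.single i 1) (EuclideanSpace.single j 1)
    rw [← hcol, ← hcol, EuclideanSpace.inner_eq_star_dotProduct, EuclideanSpace.inner_single_left,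
      dotProduct_comm] at this
    simpa [Matrix.mul_apply, dotProduct, Matrix.one_apply] using this
  · refine Matrix.ext_of_mulVec_single fun i => ?_
    rw [← Matrix.mulVec_mulVec, hUapp]
    exact congrArg WithLp.ofLp (hL (WithLp.toLp 2 (Pi.single i 1)))
lemma DifferentiableOn.matrix_det {m : Type*} [Fintype m] [DecidableEq m]
    {A : ℂ → Matrix m m ℂ} {s : Set ℂ} (hA : ∀ i j, DifferentiableOn ℂ (fun z => A z i j) s) :
    DifferentiableOn ℂ (fun z => (A z).det) s := by
  simp only [Matrix.det_apply']
  exact DifferentiableOn.fun_sum fun σ _ =>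
    (DifferentiableOn.fun_finsetProd fun i _ => hA _ _).const_mul _

lemma DifferentiableOn.matrix_inv_apply {m : Type*} [Fintype m] [DecidableEq m]
    {A : ℂ → Matrix m m ℂ} {s : Set ℂ} (hA : ∀ i j, DifferentiableOn ℂ (fun z => A z i j) s)
    (hdet : ∀ z ∈ s, (A z).det ≠ 0) (i j : m) :
    DifferentiableOn ℂ (fun z => (A z)⁻¹ i j) s := by
  simp only [Matrix.inv_def, Ring.inverse_eq_inv', Matrix.smul_apply, smul_eq_mul,
    Matrix.adjugate_apply]
  refine ((DifferentiableOn.matrix_det hA).inv hdet).mul (DifferentiableOn.matrix_det fun k l => ?_)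
  by_cases hk : k = j
  · subst hk
    simp
  · simpa [Matrix.updateRow_apply, hk] using hA k l

lemma det_one_sub_smul_ne_zero {n : Type*} [Fintype n] [DecidableEq n] {D : Matrix n n ℂ}
    (hD : (1 - Dᴴ * D).PosSemidef) {z : ℂ} (hz : ‖z‖ < 1) : (1 - z • D).det ≠ 0 := by
  intro h
  obtain ⟨v, hv, hv0⟩ := Matrix.exists_mulVec_eq_zero_iff.2 h
  rw [Matrix.sub_mulVec, Matrix.one_mulVec, sub_eq_zero, Matrix.smul_mulVec] at hv0
  have hle := (posSemidef_one_sub_conjTranspose_mul_self_iff D).1 hD v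
  have hv2 : ∑ i, ‖v i‖ ^ 2 = ‖z‖ ^ 2 * ∑ i, ‖(D *ᵥ v) i‖ ^ 2 := by
    rw [Finset.mul_sum]
    refine Finset.sum_congr rfl fun i _ => ?_
    rw [congrFun hv0 i, Pi.smul_apply, smul_eq_mul, norm_mul, mul_pow]
  have hz2 : ‖z‖ ^ 2 < 1 := by nlinarith [norm_nonneg z]
  have hnn : 0 ≤ ∑ i, ‖v i‖ ^ 2 := Finset.sum_nonneg fun i _ => sq_nonneg _
  have hsum : ∑ i, ‖v i‖ ^ 2 = 0 := by
    nlinarith [mul_le_mul_of_nonneg_left hle (sq_nonneg ‖z‖)]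
  refine hv (funext fun i => ?_)
  have := (Finset.sum_eq_zero_iff_of_nonneg fun i _ => sq_nonneg ‖v i‖).1 hsum i
    (Finset.mem_univ i)
  exact norm_eq_zero.1 (pow_eq_zero_iff two_ne_zero |>.1 this)

/-- The transfer function of an isometric colligation is contractive on the disc. -/
lemma posSemidef_transferFunction {m n : Type*} [Fintype m] [DecidableEq m] [Fintype n]
    [DecidableEq n] {A : Matrix m m ℂ} {B : Matrix m n ℂ} {C : Matrix n m ℂ} {D : Matrix n n ℂ}
    (hU : (Matrix.fromBlocks A B C D)ᴴ * Matrix.fromBlocks A B C D = 1) {z : ℂ} (hz : ‖z‖ < 1)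
    (hdet : (1 - z • D).det ≠ 0) :
    (1 - (A + z • (B * ((1 - z • D)⁻¹ * C)))ᴴ *
      (A + z • (B * ((1 - z • D)⁻¹ * C)))).PosSemidef := by
  set H := (1 - z • D)⁻¹ * C with hH
  have hfix : C + z • (D * H) = H := by
    have : (1 - z • D) * H = C := by
      rw [hH, Matrix.mul_nonsing_inv_cancel_left _ _ (isUnit_iff_ne_zero.2 hdet)]
    rw [Matrix.sub_mul, Matrix.one_mul, Matrix.smul_mul] at this
    rw [← this, sub_add_cancel]
  set F := A + z • (B * H) with hF
  have hcol : Matrix.fromBlocks A B C D * Matrix.fromRows (1 : Matrix m m ℂ) (z • H) =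
      Matrix.fromRows F H := by
    rw [Matrix.fromBlocks_mul_fromRows, Matrix.mul_one, Matrix.mul_one, Matrix.mul_smul,
      Matrix.mul_smul, hfix]
  have hgram := congrArg (fun M : Matrix (m ⊕ n) m ℂ => Mᴴ * M) hcol
  beta_reduce at hgram
  rw [Matrix.conjTranspose_mul, Matrix.mul_assoc, ← Matrix.mul_assoc _ (Matrix.fromBlocks A B C D),
    hU, Matrix.one_mul, Matrix.conjTranspose_fromRows_eq_fromCols_conjTranspose,
    Matrix.conjTranspose_fromRows_eq_fromCols_conjTranspose, Matrix.fromCols_mul_fromRows,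
    Matrix.fromCols_mul_fromRows, Matrix.conjTranspose_one, Matrix.one_mul,
    Matrix.conjTranspose_smul, Matrix.smul_mul, Matrix.mul_smul, smul_smul] at hgram
  have heq : 1 - Fᴴ * F = (1 - star z * z) • (Hᴴ * H) := by
    rw [sub_smul, one_smul, sub_eq_sub_iff_add_eq_add, hgram, add_comm]
  rw [heq]
  refine (Matrix.posSemidef_conjTranspose_mul_self H).smul ?_
  have hz2 : ‖z‖ ^ 2 ≤ 1 := by nlinarith [norm_nonneg z]
  rw [sub_nonneg, Complex.star_def, Complex.conj_mul']
  exact_mod_cast hz2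

lemma DifferentiableOn.transferFunction_apply {m n : Type*} [Fintype m] [Fintype n]
    [DecidableEq n] {A : Matrix m m ℂ} {B : Matrix m n ℂ} {C : Matrix n m ℂ} {D : Matrix n n ℂ}
    {s : Set ℂ} (hdet : ∀ z ∈ s, (1 - z • D).det ≠ 0) (i j : m) :
    DifferentiableOn ℂ (fun z : ℂ => (A + z • (B * ((1 - z • D)⁻¹ * C))) i j) s := by
  have hinv : ∀ k l, DifferentiableOn ℂ (fun z : ℂ => (1 - z • D)⁻¹ k l) s := by
    refine DifferentiableOn.matrix_inv_apply (fun k l => ?_) hdet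
    simp only [Matrix.sub_apply, Matrix.smul_apply, smul_eq_mul]
    fun_prop
  simp only [Matrix.add_apply, Matrix.smul_apply, Matrix.mul_apply, smul_eq_mul]
  refine (differentiableOn_id.mul (DifferentiableOn.fun_sum fun k _ =>
    (DifferentiableOn.fun_sum fun l _ => ?_).const_mul _)).const_add _
  exact (hinv k l).mul_const _

lemma one_sub_conj_mul_ne_zero {a b : ℂ} (ha : ‖a‖ < 1) (hb : ‖b‖ ≤ 1) :
    1 - (starRingEnd ℂ) a * b ≠ 0 := by
  intro h
  have : ‖(starRingEnd ℂ) a * b‖ = 1 := by rw [← sub_eq_zero.1 h, norm_one]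
  rw [norm_mul, Complex.norm_conj] at this
  nlinarith [norm_nonneg a, norm_nonneg b]

/-- The sufficiency half of the matrix-valued Nevanlinna-Pick theorem. -/
lemma exists_schur_interpolant {ι m : Type*} [Fintype ι] [DecidableEq ι] [Fintype m]
    [DecidableEq m] {lam : ι → ℂ} (hlam : ∀ k, ‖lam k‖ < 1) {W : ι → Matrix m m ℂ}
    (hP : (Matrix.of fun p q : ι × m =>
      (1 - (W p.1)ᴴ * W q.1) p.2 q.2 / (1 - (starRingEnd ℂ) (lam p.1) * lam q.1)).PosSemidef) :
    ∃ F : ℂ → Matrix m m ℂ,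
      (∀ i j, DifferentiableOn ℂ (fun z => F z i j) (Metric.ball 0 1)) ∧
      (∀ z ∈ Metric.ball (0 : ℂ) 1, (1 - (F z)ᴴ * F z).PosSemidef) ∧ ∀ k, F (lam k) = W k := by
  obtain ⟨d, L, hL⟩ := hP.exists_eq_conjTranspose_mul_self
  set R : Matrix m (ι × m) ℂ := Matrix.of fun i q => (1 : Matrix m m ℂ) i q.2 with hR
  set V : Matrix m (ι × m) ℂ := Matrix.of fun i q => W q.1 i q.2 with hV
  set L' : Matrix (Fin d) (ι × m) ℂ := Matrix.of fun i q => lam q.1 * L i q with hL'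
  have hgram : (Matrix.fromRows R L')ᴴ * Matrix.fromRows R L' =
      (Matrix.fromRows V L)ᴴ * Matrix.fromRows V L := by
    rw [Matrix.conjTranspose_fromRows_eq_fromCols_conjTranspose,
      Matrix.conjTranspose_fromRows_eq_fromCols_conjTranspose, Matrix.fromCols_mul_fromRows,
      Matrix.fromCols_mul_fromRows]
    ext ⟨k, i⟩ ⟨l, j⟩
    have h := congrFun (congrFun hL (k, i)) (l, j)
    rw [Matrix.of_apply, div_eq_iff (one_sub_conj_mul_ne_zero (hlam k) (hlam l).le)] at h
    have h₁ : (Rᴴ * R) (k, i) (l, j) = (1 : Matrix m m ℂ) i j := by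
      simp [hR, Matrix.mul_apply, Matrix.one_apply, eq_comm]
    have h₂ : (Vᴴ * V) (k, i) (l, j) = ((W k)ᴴ * W l) i j := by
      simp [hV, Matrix.mul_apply]
    have h₃ : (L'ᴴ * L') (k, i) (l, j) =
        (starRingEnd ℂ) (lam k) * lam l * (Lᴴ * L) (k, i) (l, j) := by
      simp only [hL', Matrix.mul_apply, Matrix.conjTranspose_apply, Matrix.of_apply, star_mul',
        Finset.mul_sum, Complex.star_def]
      exact Finset.sum_congr rfl fun a _ => by ring
    rw [Matrix.add_apply, Matrix.add_apply, h₁, h₂, h₃]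
    rw [Matrix.sub_apply] at h
    linear_combination h
  obtain ⟨U, hU, hUmul⟩ := Matrix.exists_isometry_mul_eq hgram
  obtain ⟨A, B, C, D, rfl⟩ : ∃ A B C D, U = Matrix.fromBlocks A B C D :=
    ⟨_, _, _, _, (Matrix.fromBlocks_toBlocks U).symm⟩
  rw [Matrix.fromBlocks_mul_fromRows, Matrix.fromRows_inj.eq_iff] at hUmul
  have hD : (1 - Dᴴ * D).PosSemidef := by
    have h := hU
    rw [Matrix.fromBlocks_conjTranspose, Matrix.fromBlocks_multiply, ← Matrix.fromBlocks_one,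
      Matrix.fromBlocks_inj] at h
    rw [← h.2.2.2, add_sub_cancel_right]
    exact Matrix.posSemidef_conjTranspose_mul_self B
  have hdet : ∀ z ∈ Metric.ball (0 : ℂ) 1, (1 - z • D).det ≠ 0 := fun z hz =>
    det_one_sub_smul_ne_zero hD (mem_ball_zero_iff.1 hz)
  refine ⟨fun z => A + z • (B * ((1 - z • D)⁻¹ * C)),
    DifferentiableOn.transferFunction_apply hdet, fun z hz =>
      posSemidef_transferFunction hU (mem_ball_zero_iff.1 hz) (hdet z hz), fun k => ?_⟩
  have hk := hdet (lam k) (mem_ball_zero_iff.2 (hlam k))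
  set Lk : Matrix (Fin d) m ℂ := L.submatrix id fun i => (k, i) with hLk
  have hRk : R.submatrix id (fun i => (k, i)) = 1 := by
    ext i j
    simp [hR]
  have hVk : V.submatrix id (fun i => (k, i)) = W k := by
    ext i j
    simp [hV]
  have hL'k : L'.submatrix id (fun i => (k, i)) = lam k • Lk := by
    ext i j
    simp [hL', hLk]
  have h₁ := congrArg (fun M => M.submatrix id fun i => (k, i)) hUmul.1
  have h₂ := congrArg (fun M => M.submatrix id fun i => (k, i)) hUmul.2
  simp only [Matrix.submatrix_add, Pi.add_apply,
    Matrix.submatrix_mul _ _ id id _ Function.bijective_id, Matrix.submatrix_id_id, hRk, hVk, hL'k,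
    Matrix.mul_one, Matrix.mul_smul] at h₁ h₂
  have hsolve : (1 - lam k • D)⁻¹ * C = Lk := by
    have : C = (1 - lam k • D) * Lk := by
      rw [Matrix.sub_mul, Matrix.one_mul, Matrix.smul_mul, eq_sub_iff_add_eq]
      exact h₂
    rw [this, Matrix.nonsing_inv_mul_cancel_left _ _ (isUnit_iff_ne_zero.2 hk)]
  change A + lam k • (B * ((1 - lam k • D)⁻¹ * C)) = W k
  rw [hsolve, h₁]

lemma circleAverage_conj {f : ℂ → ℂ} {c : ℂ} {R : ℝ} (hf : CircleIntegrable f c R) :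
    Real.circleAverage (fun z => (starRingEnd ℂ) (f z)) c R =
      (starRingEnd ℂ) (Real.circleAverage f c R) :=
  (Complex.conjCLE : ℂ →L[ℝ] ℂ).circleAverage_comp_comm hf

lemma circleAverage_nonneg_of_complex_nonneg {f : ℂ → ℂ} {c : ℂ} {R : ℝ}
    (hf : CircleIntegrable f c R) (h : ∀ z ∈ Metric.sphere c |R|, 0 ≤ f z) :
    0 ≤ Real.circleAverage f c R := by
  have hre := Complex.reCLM.circleAverage_comp_comm hf
  have him := Complex.imCLM.circleAverage_comp_comm hf
  rw [Complex.nonneg_iff]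
  constructor
  · rw [← Complex.reCLM_apply, ← hre]
    exact Real.circleAverage_nonneg_of_nonneg fun z hz => (Complex.nonneg_iff.1 (h z hz)).1
  · rw [← Complex.imCLM_apply, ← him]
    refine ((Real.circleAverage_congr_sphere (f₂ := fun _ => 0) fun z hz => ?_).trans
      (Real.circleAverage_const 0 c R)).symm
    exact (Complex.nonneg_iff.1 (h z hz)).2.symm

/-- Entrywise circle averages preserve positive semidefiniteness. -/
lemma posSemidef_circleAverage {n : Type*} [Fintype n] {M : ℂ → Matrix n n ℂ} {c : ℂ} {R : ℝ}
    (hint : ∀ i j, CircleIntegrable (fun z => M z i j) c R)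
    (hM : ∀ z ∈ Metric.sphere c |R|, (M z).PosSemidef) :
    (Matrix.of fun i j => Real.circleAverage (fun z => M z i j) c R).PosSemidef := by
  refine Matrix.PosSemidef.of_dotProduct_mulVec_nonneg ?_ fun x => ?_
  · ext i j
    rw [Matrix.conjTranspose_apply, Matrix.of_apply, Matrix.of_apply, Complex.star_def,
      ← circleAverage_conj (hint j i)]
    exact Real.circleAverage_congr_sphere fun z hz => (hM z hz).1.apply i j
  · have hint₁ : ∀ i j, CircleIntegrable (fun z => M z i j * x j) c R := fun i j =>
      (hint i j).mul_continuousOn continuousOn_const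
    have hint₂ : ∀ i, CircleIntegrable (fun z => ∑ j, M z i j * x j) c R := fun i =>
      CircleIntegrable.fun_sum _ fun j _ => hint₁ i j
    have hint₃ : ∀ i, CircleIntegrable (fun z => star (x i) * ∑ j, M z i j * x j) c R := fun i =>
      (hint₂ i).const_fun_smul
    have h : star x ⬝ᵥ ((Matrix.of fun i j => Real.circleAverage (fun z => M z i j) c R) *ᵥ x) =
        Real.circleAverage (fun z => star x ⬝ᵥ (M z *ᵥ x)) c R := by
      simp only [dotProduct, Matrix.mulVec, Matrix.of_apply, Pi.star_apply]
      rw [Real.circleAverage_fun_sum fun i _ => hint₃ i]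
      refine Finset.sum_congr rfl fun i _ => ?_
      have h₁ := Real.circleAverage_fun_smul (a := star (x i)) (c := c) (R := R)
        (f := fun z => ∑ j, M z i j * x j)
      simp only [smul_eq_mul] at h₁
      rw [h₁, Real.circleAverage_fun_sum fun j _ => hint₁ i j]
      congr 1
      refine Finset.sum_congr rfl fun j _ => ?_
      have h₂ := Real.circleAverage_fun_smul (a := x j) (c := c) (R := R) (f := fun z => M z i j)
      simp only [smul_eq_mul, mul_comm (x j)] at h₂
      exact h₂.symm
    rw [h]
    exact circleAverage_nonneg_of_complex_nonneg (CircleIntegrable.fun_sum _ fun i _ => hint₃ i)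
      fun z hz => (hM z hz).dotProduct_mulVec_nonneg x

lemma continuousOn_div_sub_sphere {a : ℂ} (ha : ‖a‖ < 1) :
    ContinuousOn (fun z : ℂ => z / (z - a)) (Metric.sphere 0 1) := by
  refine continuousOn_id.div (by fun_prop) fun z hz h => ?_
  rw [mem_sphere_zero_iff_norm, sub_eq_zero.1 h] at hz
  exact ha.ne hz

/-- Cauchy's formula against a product of two Szego kernels. -/
lemma circleAverage_conj_szego_mul_szego_mul {a b : ℂ} (ha : ‖a‖ < 1) (hb : ‖b‖ < 1) {f : ℂ → ℂ}
    (hf : DiffContOnCl ℂ f (Metric.ball 0 1)) :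
    Real.circleAverage (fun z => (starRingEnd ℂ) (z / (z - a)) * (z / (z - b)) * f z) 0 1 =
      f b / (1 - (starRingEnd ℂ) a * b) := by
  have hg : DiffContOnCl ℂ (fun z => (1 - (starRingEnd ℂ) a * z)⁻¹ • f z) (Metric.ball 0 |1|) := by
    rw [abs_one]
    refine DiffContOnCl.smul (DiffContOnCl.inv (f := fun z => 1 - (starRingEnd ℂ) a * z)
      (Differentiable.diffContOnCl (by fun_prop)) fun z hz => ?_) hf
    rw [closure_ball _ one_ne_zero, mem_closedBall_zero_iff] at hz
    exact one_sub_conj_mul_ne_zero ha hz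
  have hval := hg.circleAverage_smul_div (w := b) (by simpa using hb)
  rw [div_eq_inv_mul, ← smul_eq_mul, ← hval]
  refine Real.circleAverage_congr_sphere fun z hz => ?_
  rw [abs_one, mem_sphere_zero_iff_norm] at hz
  have hz0 : z ≠ 0 := norm_ne_zero_iff.1 (by rw [hz]; exact one_ne_zero)
  have hconj : (starRingEnd ℂ) z = z⁻¹ := (Complex.inv_eq_conj hz).symm
  have h₁ := one_sub_conj_mul_ne_zero ha hz.le
  have h₂ : z⁻¹ - (starRingEnd ℂ) a = (1 - (starRingEnd ℂ) a * z) / z := by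
    field_simp
  simp only [map_div₀, map_sub, hconj, sub_zero, smul_eq_mul]
  rw [h₂]
  field_simp

/-- The necessity half of the matrix-valued Nevanlinna-Pick theorem. -/
lemma posSemidef_pickMatrix {ι m : Type*} [Fintype ι] [DecidableEq ι] [Fintype m] [DecidableEq m]
    {lam : ι → ℂ} (hlam : ∀ k, ‖lam k‖ < 1) {F : ℂ → Matrix m m ℂ}
    (hF : ∀ i j, DiffContOnCl ℂ (fun z => F z i j) (Metric.ball 0 1))
    (hcontr : ∀ z ∈ Metric.sphere (0 : ℂ) 1, (1 - (F z)ᴴ * F z).PosSemidef) :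
    (Matrix.of fun p q : ι × m => (1 - (F (lam p.1))ᴴ * F (lam q.1)) p.2 q.2 /
      (1 - (starRingEnd ℂ) (lam p.1) * lam q.1)).PosSemidef := by
  set R : Matrix m (ι × m) ℂ := Matrix.of fun i q => (1 : Matrix m m ℂ) i q.2 with hR
  set V : Matrix m (ι × m) ℂ := Matrix.of fun i q => F (lam q.1) i q.2 with hV
  set N : ℂ → Matrix (ι × m) (ι × m) ℂ := fun z =>
    Rᴴ * (1 - (F z)ᴴ * F z) * R + (F z * R - V)ᴴ * (F z * R - V) with hN
  set K : ℂ → Matrix (ι × m) (ι × m) ℂ := fun z =>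
    Matrix.diagonal fun q => z / (z - lam q.1) with hK
  have hpos : ∀ z ∈ Metric.sphere (0 : ℂ) |1|, ((K z)ᴴ * N z * K z).PosSemidef := by
    intro z hz
    rw [abs_one] at hz
    exact (((hcontr z hz).conjTranspose_mul_mul_same R).add
      (Matrix.posSemidef_conjTranspose_mul_self _)).conjTranspose_mul_mul_same _
  have hNeq : ∀ z, N z = Rᴴ * R - Vᴴ * F z * R - (Vᴴ * F z * R)ᴴ + Vᴴ * V := by
    intro z
    simp only [hN, Matrix.conjTranspose_sub, Matrix.conjTranspose_mul,
      Matrix.conjTranspose_conjTranspose, Matrix.mul_sub, Matrix.sub_mul, Matrix.mul_one,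
      Matrix.mul_assoc]
    abel
  set G : ι × m → ι × m → ℂ → ℂ := fun p q z => ((F (lam p.1))ᴴ * F z) p.2 q.2 with hG
  have hNapp : ∀ z p q, N z p q = (1 : Matrix m m ℂ) p.2 q.2 - G p q z -
      (starRingEnd ℂ) (G q p z) + G p q (lam q.1) := by
    intro z p q
    rw [hNeq]
    have h₁ : (Rᴴ * R) p q = (1 : Matrix m m ℂ) p.2 q.2 := by
      simp [hR, Matrix.mul_apply, Matrix.one_apply, eq_comm]
    have h₂ : ∀ p q, (Vᴴ * F z * R) p q = G p q z := by
      intro p q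
      simp [hR, hV, hG, Matrix.mul_apply, Matrix.one_apply]
    have h₃ : (Vᴴ * V) p q = G p q (lam q.1) := by
      simp [hV, hG, Matrix.mul_apply]
    rw [Matrix.add_apply, Matrix.sub_apply, Matrix.sub_apply, Matrix.conjTranspose_apply, h₁, h₂,
      h₂, h₃]
    rfl
  have hGdiff : ∀ p q, DiffContOnCl ℂ (G p q) (Metric.ball 0 1) := by
    intro p q
    simp only [hG, Matrix.mul_apply]
    exact ⟨DifferentiableOn.fun_sum fun i _ => (hF i q.2).differentiableOn.const_mul _,
      continuousOn_finsetSum _ fun i _ => continuousOn_const.mul (hF i q.2).continuousOn⟩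
  set f : ι × m → ι × m → ℂ → ℂ := fun p q z =>
    (1 : Matrix m m ℂ) p.2 q.2 + G p q (lam q.1) - G p q z with hf
  have hfdiff : ∀ p q, DiffContOnCl ℂ (f p q) (Metric.ball 0 1) := fun p q =>
    diffContOnCl_const.sub (hGdiff p q)
  have happ : ∀ z p q, ((K z)ᴴ * N z * K z) p q =
      (starRingEnd ℂ) (z / (z - lam p.1)) * (z / (z - lam q.1)) * f p q z -
      (starRingEnd ℂ) ((starRingEnd ℂ) (z / (z - lam q.1)) * (z / (z - lam p.1)) * G q p z) := by
    intro z p q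
    simp only [hK, Matrix.diagonal_conjTranspose, Matrix.mul_diagonal, Matrix.diagonal_mul, hNapp,
      hf, Pi.star_apply, Complex.star_def, map_mul, Complex.conj_conj]
    ring
  have hszego : ∀ (p q : ι × m) {g : ℂ → ℂ}, DiffContOnCl ℂ g (Metric.ball 0 1) →
      CircleIntegrable
        (fun z => (starRingEnd ℂ) (z / (z - lam p.1)) * (z / (z - lam q.1)) * g z) 0 1 := by
    intro p q g hg
    refine ContinuousOn.circleIntegrable zero_le_one ?_
    exact ((Complex.continuous_conj.comp_continuousOn
      (continuousOn_div_sub_sphere (hlam p.1))).mul (continuousOn_div_sub_sphere (hlam q.1))).mul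
      (hg.continuousOn_ball.mono Metric.sphere_subset_closedBall)
  have hconj : ∀ (p q : ι × m) {g : ℂ → ℂ}, DiffContOnCl ℂ g (Metric.ball 0 1) →
      CircleIntegrable (fun z => (starRingEnd ℂ)
        ((starRingEnd ℂ) (z / (z - lam p.1)) * (z / (z - lam q.1)) * g z)) 0 1 := by
    intro p q g hg
    refine ContinuousOn.circleIntegrable zero_le_one (Complex.continuous_conj.comp_continuousOn ?_)
    exact ((Complex.continuous_conj.comp_continuousOn
      (continuousOn_div_sub_sphere (hlam p.1))).mul (continuousOn_div_sub_sphere (hlam q.1))).mul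
      (hg.continuousOn_ball.mono Metric.sphere_subset_closedBall)
  convert posSemidef_circleAverage (fun p q => ?_) hpos using 1
  · ext p q
    simp only [Matrix.of_apply, happ]
    rw [Real.circleAverage_fun_sub (hszego p q (hfdiff p q)) (hconj q p (hGdiff q p)),
      circleAverage_conj (hszego q p (hGdiff q p)),
      circleAverage_conj_szego_mul_szego_mul (hlam _) (hlam _) (hfdiff p q),
      circleAverage_conj_szego_mul_szego_mul (hlam _) (hlam _) (hGdiff q p)]
    have h₁ : (starRingEnd ℂ) (G q p (lam p.1)) = G p q (lam q.1) := by
      simp [hG, Matrix.mul_apply, mul_comm]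
    simp only [map_div₀, h₁, hf, map_sub, map_one, map_mul, Complex.conj_conj,
      mul_comm (lam q.1), ← sub_div, add_sub_cancel_right]
    rfl
  · simp only [happ]
    exact (hszego p q (hfdiff p q)).sub (hconj q p (hGdiff q p))

lemma exists_entire_re_eq_of_mem_span_fourier {f : C(AddCircle (2 * Real.pi), ℂ)}
    (hf : f ∈ Submodule.span ℂ (Set.range (fourier (T := 2 * Real.pi)))) (a : ℂ) :
    ∃ p : ℂ → ℂ, Differentiable ℂ p ∧
      ∀ t, (p (AddCircle.toCircle t)).re = (a * f t).re := by
  induction hf using Submodule.span_induction generalizing a with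
  | mem f hf =>
    obtain ⟨n, rfl⟩ := hf
    obtain ⟨k, rfl | rfl⟩ := n.eq_nat_or_neg
    · refine ⟨fun z => a * z ^ k, by fun_prop, fun t => ?_⟩
      change (a * _ ^ k).re = _
      rw [fourier_apply, natCast_zsmul, AddCircle.toCircle_nsmul, Circle.coe_pow]
    · refine ⟨fun z => (starRingEnd ℂ) a * z ^ k, by fun_prop, fun t => ?_⟩
      rw [← Complex.conj_re]
      rw [fourier_apply, neg_smul, natCast_zsmul, AddCircle.toCircle_neg, AddCircle.toCircle_nsmul,
        Circle.coe_inv_eq_conj, Circle.coe_pow, map_mul, Complex.conj_conj]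
  | zero => exact ⟨0, differentiable_const 0, fun t => by simp⟩
  | add f g _ _ hf hg =>
    obtain ⟨p, hp, hp'⟩ := hf a
    obtain ⟨q, hq, hq'⟩ := hg a
    refine ⟨p + q, hp.add hq, fun t => ?_⟩
    simp only [Pi.add_apply, Complex.add_re, hp', hq', ContinuousMap.add_apply, mul_add]
  | smul c f _ hf =>
    obtain ⟨p, hp, hp'⟩ := hf (a * c)
    refine ⟨p, hp, fun t => ?_⟩
    rw [hp', ContinuousMap.smul_apply, smul_eq_mul, mul_assoc]

/-- Real parts of entire functions are uniformly dense in the real continuous functions on the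
unit circle. -/
lemma exists_entire_abs_re_sub_lt {φ : ℂ → ℝ} (hφ : ContinuousOn φ (Metric.sphere 0 1)) {ε : ℝ}
    (hε : 0 < ε) :
    ∃ p : ℂ → ℂ, Differentiable ℂ p ∧ ∀ z ∈ Metric.sphere (0 : ℂ) 1, |(p z).re - φ z| < ε := by
  have : Fact (0 < 2 * Real.pi) := ⟨Real.two_pi_pos⟩
  have hc : Continuous fun t : AddCircle (2 * Real.pi) => (φ (AddCircle.toCircle t) : ℂ) := by
    refine Complex.continuous_ofReal.comp (hφ.comp_continuous
      (continuous_subtype_val.comp AddCircle.continuous_toCircle) fun t => ?_)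
    exact (AddCircle.toCircle t).2
  have hmem : (⟨_, hc⟩ : C(AddCircle (2 * Real.pi), ℂ)) ∈
      closure (Submodule.span ℂ (Set.range (fourier (T := 2 * Real.pi))) : Set _) := by
    rw [← Submodule.topologicalClosure_coe, span_fourier_closure_eq_top]
    trivial
  obtain ⟨f, hf, hdist⟩ := Metric.mem_closure_iff.1 hmem ε hε
  obtain ⟨p, hp, hp'⟩ := exists_entire_re_eq_of_mem_span_fourier hf 1
  refine ⟨p, hp, fun z hz => ?_⟩
  obtain ⟨t, ht⟩ := (AddCircle.homeomorphCircle Real.two_pi_pos.ne').surjective ⟨z, hz⟩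
  rw [AddCircle.homeomorphCircle_apply] at ht
  have hz' : (AddCircle.toCircle t : ℂ) = z := congrArg Subtype.val ht
  have hft := (ContinuousMap.dist_apply_le_dist t).trans_lt hdist
  rw [dist_comm, Complex.dist_eq] at hft
  change ‖f t - (φ (AddCircle.toCircle t) : ℂ)‖ < ε at hft
  rw [hz'] at hft
  have hpz := hp' t
  rw [hz', one_mul] at hpz
  rw [hpz, ← Complex.ofReal_re (φ z), ← Complex.sub_re]
  exact (Complex.abs_re_le_norm _).trans_lt hft

/-- Smoothed outer functions with prescribed modulus on the unit circle. -/
lemma exists_entire_exp_norm_sq_approx {G : ℂ → ℝ} (hG : ContinuousOn G (Metric.sphere 0 1))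
    (hG0 : ∀ z ∈ Metric.sphere (0 : ℂ) 1, 0 ≤ G z) {δ : ℝ} (hδ : 0 < δ) :
    ∃ c : ℂ → ℂ, Differentiable ℂ c ∧ (∀ z, c z ≠ 0) ∧ ∀ z ∈ Metric.sphere (0 : ℂ) 1,
      G z + δ ≤ ‖c z‖ ^ 2 ∧ ‖c z‖ ^ 2 ≤ (1 + δ) * (G z + δ) := by
  have hpos : ∀ z ∈ Metric.sphere (0 : ℂ) 1, 0 < G z + δ := fun z hz => by
    linarith [hG0 z hz]
  have hlog : 0 < Real.log (1 + δ) := Real.log_pos (by linarith)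
  obtain ⟨p, hp, happrox⟩ := exists_entire_abs_re_sub_lt
    (φ := fun z => Real.log (G z + δ) + Real.log (1 + δ) / 2)
    (((hG.add continuousOn_const).log fun z hz => (hpos z hz).ne').add continuousOn_const)
    (half_pos hlog)
  refine ⟨fun z => Complex.exp (p z / 2), by fun_prop, fun z => Complex.exp_ne_zero _,
    fun z hz => ?_⟩
  have hnorm : ‖Complex.exp (p z / 2)‖ ^ 2 = Real.exp (p z).re := by
    rw [Complex.norm_exp, ← Real.exp_nat_mul]
    congr 1
    simp
    ring
  have h := abs_lt.1 (happrox z hz)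
  rw [hnorm, ← Real.log_le_iff_le_exp (hpos z hz), ← Real.le_log_iff_exp_le
    (mul_pos (by linarith) (hpos z hz)), Real.log_mul (by linarith) (hpos z hz).ne']
  constructor <;> linarith

/-- Interpolation data for a strict dilation of an analytic map into the closed tetrablock. -/
lemma exists_pick_data_dilation {ι : Type*} [Fintype ι] [DecidableEq ι] {lam : ι → ℂ}
    (hlam : ∀ k, ‖lam k‖ < 1) {x : ℂ → ℂ × ℂ × ℂ} (hx : DifferentiableOn ℂ x (Metric.ball 0 1))
    (hmem : ∀ z ∈ Metric.ball (0 : ℂ) 1, x z ∈ closedTetra) {t : ℝ} (ht0 : 0 < t) (ht1 : t < 1) :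
    ∃ b c : ι → ℂ,
      (∀ k, b k * c k =
        t ^ 2 * ((x (t * lam k)).1 * (x (t * lam k)).2.1 - (x (t * lam k)).2.2)) ∧
      (Matrix.of (fun p q : ι × Fin 2 =>
        ((1 - (!![t * (x (t * lam p.1)).1, b p.1; c p.1, t * (x (t * lam p.1)).2.1])ᴴ *
          !![t * (x (t * lam q.1)).1, b q.1; c q.1, t * (x (t * lam q.1)).2.1]) p.2 q.2) /
          (1 - (starRingEnd ℂ) (lam p.1) * lam q.1))).PosSemidef := by
  have hmaps : ∀ z ∈ Metric.closedBall (0 : ℂ) 1, (t : ℂ) * z ∈ Metric.ball (0 : ℂ) 1 := by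
    intro z hz
    rw [mem_closedBall_zero_iff] at hz
    rw [mem_ball_zero_iff, norm_mul, Complex.norm_real, Real.norm_of_nonneg ht0.le]
    nlinarith
  have hsub : Metric.ball (0 : ℂ) 1 ⊆ Metric.closedBall 0 1 := Metric.ball_subset_closedBall
  set y : ℂ → ℂ × ℂ × ℂ := fun z => x (t * z) with hy
  have hyd : DifferentiableOn ℂ y (Metric.ball 0 1) :=
    hx.comp (by fun_prop) fun z hz => hmaps z (hsub hz)
  have hyc : ContinuousOn y (closure (Metric.ball 0 1)) := by
    rw [closure_ball _ one_ne_zero]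
    exact hx.continuousOn.comp (by fun_prop) hmaps
  have hydc : DiffContOnCl ℂ y (Metric.ball 0 1) := ⟨hyd, hyc⟩
  have hy₁ : DiffContOnCl ℂ (fun z => (y z).1) (Metric.ball 0 1) := ⟨hyd.fst, hyc.fst⟩
  have hy₂ : DiffContOnCl ℂ (fun z => (y z).2.1) (Metric.ball 0 1) := ⟨hyd.snd.fst, hyc.snd.fst⟩
  have hy₃ : DiffContOnCl ℂ (fun z => (y z).2.2) (Metric.ball 0 1) := ⟨hyd.snd.snd, hyc.snd.snd⟩
  have hg : DiffContOnCl ℂ (fun z => (y z).1 * (y z).2.1 - (y z).2.2) (Metric.ball 0 1) :=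
    (hy₁.smul hy₂).sub hy₃
  set g : ℂ → ℂ := fun z => (y z).1 * (y z).2.1 - (y z).2.2 with hg_def
  set δ : ℝ := (1 - t ^ 2) ^ 2 / 3 with hδ
  have ht2 : 0 < 1 - t ^ 2 := by nlinarith
  have hδ0 : 0 < δ := by positivity
  have hδ1 : δ ≤ 1 / 3 := by
    rw [hδ]
    nlinarith [sq_nonneg t]
  obtain ⟨c, hc, hc0, hcG⟩ := exists_entire_exp_norm_sq_approx (G := fun z => t ^ 2 * ‖g z‖)
    (continuousOn_const.mul ((hg.continuousOn_ball.mono Metric.sphere_subset_closedBall).norm))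
    (fun z _ => by positivity) hδ0
  have hb : DiffContOnCl ℂ (fun z => (c z)⁻¹ • ((t : ℂ) ^ 2 • g) z) (Metric.ball 0 1) :=
    (hc.diffContOnCl.inv fun z _ => hc0 z).smul (hg.const_smul ((t : ℂ) ^ 2))
  set b : ℂ → ℂ := fun z => (c z)⁻¹ • ((t : ℂ) ^ 2 • g) z with hb_def
  have hbc : ∀ z, b z * c z = t ^ 2 * g z := by
    intro z
    have := hc0 z
    simp only [hb_def, Pi.smul_apply, smul_eq_mul]
    field_simp
  refine ⟨fun k => b (lam k), fun k => c (lam k), fun k => hbc _, ?_⟩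
  refine posSemidef_pickMatrix hlam
    (F := fun z => !![t * (y z).1, b z; c z, t * (y z).2.1]) ?_ fun z hz => ?_
  · intro i j
    fin_cases i <;> fin_cases j
    · exact hy₁.const_smul (t : ℂ)
    · exact hb
    · exact hc.diffContOnCl
    · exact hy₂.const_smul (t : ℂ)
  · obtain ⟨hn₃, hn⟩ := norm_bounds_of_mem_closedTetra
      (hmem _ (hmaps z (Metric.sphere_subset_closedBall hz)))
    obtain ⟨hl, hu⟩ := hcG z hz
    change ‖(y z).2.2‖ ≤ 1 at hn₃
    change ‖(y z).1‖ ^ 2 + ‖(y z).2.1‖ ^ 2 + 2 * ‖g z‖ ≤ 1 + ‖(y z).2.2‖ ^ 2 at hn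
    have hdet : (t : ℂ) * (y z).1 * (t * (y z).2.1) - b z * c z = t ^ 2 * (y z).2.2 := by
      rw [hbc, hg_def]
      ring
    have htn : ‖(t : ℂ)‖ = t := by rw [Complex.norm_real, Real.norm_of_nonneg ht0.le]
    have hsq : ‖(y z).2.2‖ ^ 2 ≤ 1 := pow_le_one₀ (norm_nonneg _) hn₃
    have hG0 : 0 ≤ t ^ 2 * ‖g z‖ := by positivity
    have hG1 : t ^ 2 * ‖g z‖ ≤ 1 := by
      have : ‖g z‖ ≤ 1 := by nlinarith [sq_nonneg ‖(y z).1‖, sq_nonneg ‖(y z).2.1‖]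
      nlinarith [norm_nonneg (g z)]
    have hbsq : ‖b z‖ ^ 2 ≤ t ^ 2 * ‖g z‖ := by
      have h : ‖b z‖ ^ 2 * ‖c z‖ ^ 2 = (t ^ 2 * ‖g z‖) ^ 2 := by
        rw [← mul_pow, ← norm_mul, hbc, norm_mul, norm_pow, htn]
      have hcp : 0 < ‖c z‖ ^ 2 := by
        have := hc0 z
        positivity
      refine le_of_mul_le_mul_right ?_ hcp
      rw [h, sq]
      exact mul_le_mul_of_nonneg_left (by linarith) hG0
    apply posSemidef_one_sub_conjTranspose_mul_self_fin_two
    · rw [hdet, norm_mul, norm_pow, htn]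
      nlinarith [norm_nonneg (y z).2.2]
    · rw [hdet, norm_mul, norm_mul, norm_mul, norm_pow, htn]
      have hsum : ‖b z‖ ^ 2 + ‖c z‖ ^ 2 ≤ 2 * (t ^ 2 * ‖g z‖) + (1 - t ^ 2) ^ 2 := by
        nlinarith
      have hscale := mul_le_mul_of_nonneg_left hn (sq_nonneg t)
      nlinarith [mul_nonneg (mul_nonneg (sq_nonneg t) ht2.le) (sub_nonneg.2 hsq)]

lemma Matrix.PosSemidef.of_tendsto {n α : Type*} [Fintype n] {l : Filter α} [l.NeBot]
    {A : α → Matrix n n ℂ} {B : Matrix n n ℂ} (hA : ∀ᶠ a in l, (A a).PosSemidef)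
    (h : Filter.Tendsto A l (nhds B)) : B.PosSemidef := by
  refine Matrix.PosSemidef.of_dotProduct_mulVec_nonneg ?_ fun x => ?_
  · refine tendsto_nhds_unique_of_eventuallyEq
      ((Continuous.matrix_conjTranspose continuous_id).tendsto B |>.comp h) h ?_
    exact hA.mono fun a ha => ha.1
  · have hc : Continuous fun M : Matrix n n ℂ => star x ⬝ᵥ (M *ᵥ x) := by fun_prop
    exact ge_of_tendsto ((hc.tendsto B).comp h) (hA.mono fun a ha => ha.dotProduct_mulVec_nonneg x)

lemma norm_entry_le_one_of_diag_nonneg {a b c d μ : ℂ} (hμ : ‖μ‖ < 1)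
    (h : ∀ i, 0 ≤ (1 - (!![a, b; c, d])ᴴ * !![a, b; c, d]) i i / (1 - (starRingEnd ℂ) μ * μ)) :
    ‖b‖ ≤ 1 ∧ ‖c‖ ≤ 1 := by
  have hμ' : 0 < 1 - ‖μ‖ ^ 2 := by nlinarith [norm_nonneg μ]
  have hden : 1 - (starRingEnd ℂ) μ * μ = ((1 - ‖μ‖ ^ 2 : ℝ) : ℂ) := by
    rw [Complex.conj_mul']
    push_cast
    rfl
  have h₀ := h 0
  have h₁ := h 1
  have e₀ : (1 - (!![a, b; c, d])ᴴ * !![a, b; c, d]) 0 0 =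
      ((1 - (‖a‖ ^ 2 + ‖c‖ ^ 2) : ℝ) : ℂ) := by
    simp [Matrix.mul_apply, Complex.conj_mul']
  have e₁ : (1 - (!![a, b; c, d])ᴴ * !![a, b; c, d]) 1 1 =
      ((1 - (‖b‖ ^ 2 + ‖d‖ ^ 2) : ℝ) : ℂ) := by
    simp [Matrix.mul_apply, Complex.conj_mul']
  rw [hden, e₀, ← Complex.ofReal_div, Complex.zero_le_real, le_div_iff₀ hμ', zero_mul] at h₀
  rw [hden, e₁, ← Complex.ofReal_div, Complex.zero_le_real, le_div_iff₀ hμ', zero_mul] at h₁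
  constructor <;> nlinarith [norm_nonneg b, norm_nonneg c, sq_nonneg ‖a‖, sq_nonneg ‖d‖]

/-- Interpolation data for an analytic map into the closed tetrablock. -/
lemma exists_pick_data {ι : Type*} [Fintype ι] [DecidableEq ι] {lam : ι → ℂ}
    (hlam : ∀ k, ‖lam k‖ < 1) {x : ℂ → ℂ × ℂ × ℂ} (hx : DifferentiableOn ℂ x (Metric.ball 0 1))
    (hmem : ∀ z ∈ Metric.ball (0 : ℂ) 1, x z ∈ closedTetra) :
    ∃ b c : ι → ℂ,
      (∀ k, b k * c k = (x (lam k)).1 * (x (lam k)).2.1 - (x (lam k)).2.2) ∧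
      (Matrix.of (fun p q : ι × Fin 2 =>
        ((1 - (!![(x (lam p.1)).1, b p.1; c p.1, (x (lam p.1)).2.1])ᴴ *
          !![(x (lam q.1)).1, b q.1; c q.1, (x (lam q.1)).2.1]) p.2 q.2) /
          (1 - (starRingEnd ℂ) (lam p.1) * lam q.1))).PosSemidef := by
  obtain ⟨t, -, ht, htlim⟩ := exists_seq_strictMono_tendsto' (zero_lt_one (α := ℝ))
  choose b c hbc hP using fun n => exists_pick_data_dilation hlam hx hmem (ht n).1 (ht n).2
  have hbound : ∀ n k, ‖b n k‖ ≤ 1 ∧ ‖c n k‖ ≤ 1 := fun n k =>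
    norm_entry_le_one_of_diag_nonneg (a := t n * (x (t n * lam k)).1)
      (d := t n * (x (t n * lam k)).2.1) (hlam k) fun i => by
        have h := (hP n).diag_nonneg (i := (k, i))
        rwa [Matrix.of_apply] at h
  have hK : IsCompact (Metric.closedBall (0 : (ι → ℂ) × (ι → ℂ)) 1) := isCompact_closedBall 0 1
  obtain ⟨⟨b₀, c₀⟩, -, φ, hφ, hlim⟩ := hK.tendsto_subseq (x := fun n => (b n, c n)) fun n => by
    rw [mem_closedBall_zero_iff, Prod.norm_mk, max_le_iff, pi_norm_le_iff_of_nonneg zero_le_one,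
      pi_norm_le_iff_of_nonneg zero_le_one]
    exact ⟨fun k => (hbound n k).1, fun k => (hbound n k).2⟩
  rw [nhds_prod_eq, Filter.tendsto_prod_iff'] at hlim
  have hblim : ∀ k, Filter.Tendsto (fun n => b (φ n) k) Filter.atTop (nhds (b₀ k)) :=
    tendsto_pi_nhds.1 hlim.1
  have hclim : ∀ k, Filter.Tendsto (fun n => c (φ n) k) Filter.atTop (nhds (c₀ k)) :=
    tendsto_pi_nhds.1 hlim.2
  have hτ : Filter.Tendsto (fun n => (t (φ n) : ℂ)) Filter.atTop (nhds 1) := by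
    rw [← Complex.ofReal_one]
    exact (Complex.continuous_ofReal.tendsto 1).comp (htlim.comp hφ.tendsto_atTop)
  have hxlim : ∀ k, Filter.Tendsto (fun n => x (t (φ n) * lam k)) Filter.atTop
      (nhds (x (lam k))) := by
    intro k
    have hk : lam k ∈ Metric.ball (0 : ℂ) 1 := by simpa using hlam k
    refine ((hx.continuousOn.continuousAt (Metric.isOpen_ball.mem_nhds hk)).tendsto).comp ?_
    simpa using hτ.mul_const (lam k)
  have hx₁ := fun k => (continuous_fst.tendsto _).comp (hxlim k)
  have hx₂ := fun k => ((continuous_fst.comp continuous_snd).tendsto _).comp (hxlim k)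
  have hx₃ := fun k => ((continuous_snd.comp continuous_snd).tendsto _).comp (hxlim k)
  refine ⟨b₀, c₀, fun k => ?_, ?_⟩
  · have h := (hblim k).mul (hclim k)
    simp only [hbc] at h
    refine tendsto_nhds_unique h ?_
    simpa using (hτ.pow 2).mul (((hx₁ k).mul (hx₂ k)).sub (hx₃ k))
  · refine Matrix.PosSemidef.of_tendsto (l := Filter.atTop)
      (Filter.Eventually.of_forall fun n => hP (φ n)) ?_
    have hW : ∀ k, Filter.Tendsto (fun n => !![t (φ n) * (x (t (φ n) * lam k)).1, b (φ n) k;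
        c (φ n) k, t (φ n) * (x (t (φ n) * lam k)).2.1]) Filter.atTop
        (nhds !![(x (lam k)).1, b₀ k; c₀ k, (x (lam k)).2.1]) := by
      intro k
      refine tendsto_pi_nhds.2 fun i => tendsto_pi_nhds.2 fun j => ?_
      fin_cases i <;> fin_cases j
      · simpa using hτ.mul (hx₁ k)
      · exact hblim k
      · exact hclim k
      · simpa using hτ.mul (hx₂ k)
    have hM : Continuous fun A : Matrix (Fin 2) (Fin 2) ℂ × Matrix (Fin 2) (Fin 2) ℂ =>
        1 - A.1ᴴ * A.2 := by fun_prop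
    refine tendsto_pi_nhds.2 fun p => tendsto_pi_nhds.2 fun q => ?_
    refine Filter.Tendsto.div_const ?_ _
    exact tendsto_pi_nhds.1 (tendsto_pi_nhds.1
      ((hM.tendsto _).comp ((hW p.1).prodMk_nhds (hW q.1))) p.2) q.2

theorem stmt_1 (n : ℕ) (lam : Fin n → ℂ) (hlam : ∀ k, lam k ∈ Metric.ball (0:ℂ) 1)
    (hinj : Function.Injective lam) (x₁ x₂ x₃ : Fin n → ℂ)
    (hx : ∀ k, (x₁ k, x₂ k, x₃ k) ∈ openTetra)
    (hne : ∀ k, x₁ k * x₂ k ≠ x₃ k) :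
    (∃ x : ℂ → ℂ × ℂ × ℂ,
        DifferentiableOn ℂ x (Metric.ball (0:ℂ) 1) ∧
        (∀ z ∈ Metric.ball (0:ℂ) 1, x z ∈ closedTetra) ∧
        ∀ k, x (lam k) = (x₁ k, x₂ k, x₃ k)) ↔
    (∃ b c : Fin n → ℂ,
        (∀ k, b k * c k = x₁ k * x₂ k - x₃ k) ∧
        (Matrix.of (fun p q : Fin n × Fin 2 =>
          ((1 - (!![x₁ p.1, b p.1; c p.1, x₂ p.1])ᴴ * !![x₁ q.1, b q.1; c q.1, x₂ q.1])
              p.2 q.2) /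
            (1 - (starRingEnd ℂ) (lam p.1) * lam q.1))).PosSemidef) := by
  have hlam' : ∀ k, ‖lam k‖ < 1 := fun k => mem_ball_zero_iff.1 (hlam k)
  constructor
  · rintro ⟨x, hxd, hxm, hxv⟩
    obtain ⟨b, c, hbc, hP⟩ := exists_pick_data hlam' hxd hxm
    simp only [hxv] at hbc hP
    exact ⟨b, c, hbc, hP⟩
  · rintro ⟨b, c, hbc, hP⟩
    obtain ⟨F, hF, hcontr, hval⟩ := exists_schur_interpolant hlam'
      (W := fun k => !![x₁ k, b k; c k, x₂ k]) hP
    refine ⟨fun z => (F z 0 0, F z 1 1, (F z).det),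
      (hF 0 0).prodMk ((hF 1 1).prodMk (DifferentiableOn.matrix_det hF)),
      fun z hz => mem_closedTetra_of_posSemidef (hcontr z hz), fun k => ?_⟩
    simp [hval, Matrix.det_fin_two, hbc]
end

section
/- Let H be a complex Hilbert space and let A : H → H, B₁, B₂ : ℂ → H, C₁, C₂ : H → ℂ be bounded linear operators and D₁₁, D₁₂, D₂₁, D₂₂ complex numbers such that the block operator [[A, B],[C, D]] : H ⊕ ℂ² → H ⊕ ℂ² is unitary, where B = [B₁ B₂] : ℂ² → H, C = [C₁; C₂] : H → ℂ² and D = [D_{ij}] : ℂ² → ℂ². Then for every λ ∈ 𝔻 the operator 1 − λA is invertible, and the map x = (x₁,x₂,x₃) : 𝔻 → ℂ³ defined by x₁(λ) = D₁₁ + λ C₁(1 − λA)⁻¹B₁, x₂(λ) = D₂₂ + λ C₂(1 − λA)⁻¹B₂ and x₃(λ) = det( D + λ C (1 − λA)⁻¹ B ) is analytic and satisfies x(𝔻) ⊆ Ē. -/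
/-- A contractive `2 × 2` matrix `[a, b; c, d]` gives the point `(a, d, ad - bc)` of the closed
tetrablock. -/
theorem mem_closedTetra_of_contraction {a b c d : ℂ}
    (hF : ∀ u v : ℂ, ‖a * u + b * v‖ ^ 2 + ‖c * u + d * v‖ ^ 2 ≤ ‖u‖ ^ 2 + ‖v‖ ^ 2) :
    ((a, d, Matrix.det !![a, b; c, d]) : ℂ × ℂ × ℂ) ∈ closedTetra := by
  intro z hz w hw h0
  rw [mem_ball_zero_iff] at hz hw
  have hdet : Matrix.det !![1 - a * z, -(b * w); -(c * z), 1 - d * w] = 0 := by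
    rw [← h0]
    simp only [Matrix.det_fin_two_of]
    ring
  obtain ⟨v, hv, hMv⟩ := Matrix.exists_mulVec_eq_zero_iff.mpr hdet
  have e0 := congrFun hMv 0
  have e1 := congrFun hMv 1
  simp [Matrix.mulVec, dotProduct, Fin.sum_univ_two] at e0 e1
  have h := hF (z * v 0) (w * v 1)
  rw [show a * (z * v 0) + b * (w * v 1) = v 0 by linear_combination -e0,
    show c * (z * v 0) + d * (w * v 1) = v 1 by linear_combination -e1,
    norm_mul, norm_mul, mul_pow, mul_pow] at h
  have hz2 : ‖z‖ ^ 2 < 1 := pow_lt_one₀ (norm_nonneg z) hz two_ne_zero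
  have hw2 : ‖w‖ ^ 2 < 1 := pow_lt_one₀ (norm_nonneg w) hw two_ne_zero
  have h1 : v 0 = 0 := by
    by_contra hne
    have : 0 < ‖v 0‖ ^ 2 := by positivity
    nlinarith [sq_nonneg ‖v 1‖]
  have h2 : v 1 = 0 := by
    by_contra hne
    have : 0 < ‖v 1‖ ^ 2 := by positivity
    nlinarith [sq_nonneg ‖v 0‖]
  exact hv (by ext i; fin_cases i <;> assumption)

/-- `1 - l • A` is invertible for a contraction `A` and `l` in the open unit disc. -/
theorem isUnit_one_sub_smul_of_norm_le_one {H : Type*} [NormedAddCommGroup H]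
    [InnerProductSpace ℂ H] [CompleteSpace H] {A : H →L[ℂ] H} (hA : ‖A‖ ≤ 1) {l : ℂ}
    (hl : l ∈ Metric.ball (0 : ℂ) 1) : IsUnit (1 - l • A) := by
  rw [mem_ball_zero_iff] at hl
  refine isUnit_one_sub_of_norm_lt_one ?_
  rw [norm_smul]
  exact (mul_le_of_le_one_right (norm_nonneg l) hA).trans_lt hl

/-- The resolvent entries `l ↦ D + l C (1 - l A)⁻¹ b` are holomorphic where `1 - l A` is
invertible. -/
theorem differentiableAt_transfer {H : Type*} [NormedAddCommGroup H]
    [InnerProductSpace ℂ H] [CompleteSpace H] (A : H →L[ℂ] H) (C : H →L[ℂ] ℂ) (b : H) (D : ℂ)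
    {l : ℂ} (hl : IsUnit (1 - l • A)) :
    DifferentiableAt ℂ (fun l : ℂ => D + l * C ((Ring.inverse (1 - l • A)) b)) l := by
  have hR : DifferentiableAt ℂ (fun l : ℂ => Ring.inverse (1 - l • A)) l := by
    obtain ⟨x, hx⟩ := hl
    have hinv : DifferentiableAt ℂ (Ring.inverse : (H →L[ℂ] H) → (H →L[ℂ] H)) (1 - l • A) :=
      hx ▸ differentiableAt_inverse x.isUnit
    exact hinv.comp l (f := fun l : ℂ => 1 - l • A) (by fun_prop)
  have hRb : DifferentiableAt ℂ (fun l : ℂ => (Ring.inverse (1 - l • A)) b) l :=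
    hR.clm_apply (differentiableAt_const b)
  have hC : DifferentiableAt ℂ (fun l : ℂ => C ((Ring.inverse (1 - l • A)) b)) l :=
    C.differentiableAt.comp l hRb
  exact (differentiableAt_const D).add (differentiableAt_id.mul hC)

theorem stmt_4 (H : Type) [NormedAddCommGroup H] [InnerProductSpace ℂ H] [CompleteSpace H]
    (A : H →L[ℂ] H) (B₁ B₂ : ℂ →L[ℂ] H) (C₁ C₂ : H →L[ℂ] ℂ) (D₁₁ D₁₂ D₂₁ D₂₂ : ℂ)
    (U : WithLp 2 (H × EuclideanSpace ℂ (Fin 2)) ≃ₗᵢ[ℂ]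
          WithLp 2 (H × EuclideanSpace ℂ (Fin 2)))
    (hU : ∀ (h : H) (u : EuclideanSpace ℂ (Fin 2)),
      U ((WithLp.equiv 2 (H × EuclideanSpace ℂ (Fin 2))).symm (h, u)) =
        (WithLp.equiv 2 (H × EuclideanSpace ℂ (Fin 2))).symm
          (A h + B₁ (u 0) + B₂ (u 1),
            (WithLp.equiv 2 (Fin 2 → ℂ)).symm
              ![C₁ h + D₁₁ * u 0 + D₁₂ * u 1, C₂ h + D₂₁ * u 0 + D₂₂ * u 1])) :
    (∀ l ∈ Metric.ball (0:ℂ) 1, IsUnit (1 - l • A)) ∧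
    DifferentiableOn ℂ
      (fun l => (((D₁₁ + l * C₁ ((Ring.inverse (1 - l • A)) (B₁ 1)),
                   D₂₂ + l * C₂ ((Ring.inverse (1 - l • A)) (B₂ 1)),
                   Matrix.det
                     !![D₁₁ + l * C₁ ((Ring.inverse (1 - l • A)) (B₁ 1)),
                        D₁₂ + l * C₁ ((Ring.inverse (1 - l • A)) (B₂ 1));
                        D₂₁ + l * C₂ ((Ring.inverse (1 - l • A)) (B₁ 1)),
                        D₂₂ + l * C₂ ((Ring.inverse (1 - l • A)) (B₂ 1))])) : ℂ × ℂ × ℂ))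
      (Metric.ball (0:ℂ) 1) ∧
    ∀ l ∈ Metric.ball (0:ℂ) 1,
      ((D₁₁ + l * C₁ ((Ring.inverse (1 - l • A)) (B₁ 1)),
        D₂₂ + l * C₂ ((Ring.inverse (1 - l • A)) (B₂ 1)),
        Matrix.det
          !![D₁₁ + l * C₁ ((Ring.inverse (1 - l • A)) (B₁ 1)),
             D₁₂ + l * C₁ ((Ring.inverse (1 - l • A)) (B₂ 1));
             D₂₁ + l * C₂ ((Ring.inverse (1 - l • A)) (B₁ 1)),
             D₂₂ + l * C₂ ((Ring.inverse (1 - l • A)) (B₂ 1))]) : ℂ × ℂ × ℂ) ∈ closedTetra := by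
  have hnorm (h : H) (u v : ℂ) : ‖A h + B₁ u + B₂ v‖ ^ 2 +
      (‖C₁ h + D₁₁ * u + D₁₂ * v‖ ^ 2 + ‖C₂ h + D₂₁ * u + D₂₂ * v‖ ^ 2) =
      ‖h‖ ^ 2 + (‖u‖ ^ 2 + ‖v‖ ^ 2) := by
    have key := congrArg (fun x => ‖x‖ ^ 2) (hU h !₂[u, v])
    simp only [LinearIsometryEquiv.norm_map] at key
    simpa [WithLp.prod_norm_sq_eq_of_L2, EuclideanSpace.norm_sq_eq, Fin.sum_univ_two]
      using key.symm
  have hA : ‖A‖ ≤ 1 := by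
    refine A.opNorm_le_bound zero_le_one fun h => ?_
    have key := hnorm h 0 0
    simp only [map_zero, add_zero, mul_zero, norm_zero] at key
    rw [one_mul]
    refine le_of_sq_le_sq ?_ (norm_nonneg h)
    nlinarith [sq_nonneg ‖C₁ h‖, sq_nonneg ‖C₂ h‖]
  have hunit (l : ℂ) (hl : l ∈ Metric.ball (0 : ℂ) 1) : IsUnit (1 - l • A) :=
    isUnit_one_sub_smul_of_norm_le_one hA hl
  refine ⟨hunit, fun l hl => DifferentiableAt.differentiableWithinAt ?_, fun l hl => ?_⟩
  · have d (C : H →L[ℂ] ℂ) (b : H) (D : ℂ) := differentiableAt_transfer A C b D (hunit l hl)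
    simp only [Matrix.det_fin_two_of]
    exact (d C₁ (B₁ 1) D₁₁).prodMk ((d C₂ (B₂ 1) D₂₂).prodMk
      (((d C₁ (B₁ 1) D₁₁).mul (d C₂ (B₂ 1) D₂₂)).sub
        ((d C₁ (B₂ 1) D₁₂).mul (d C₂ (B₁ 1) D₂₁))))
  · refine mem_closedTetra_of_contraction fun u v => ?_
    set R := Ring.inverse (1 - l • A)
    set g := u • R (B₁ 1) + v • R (B₂ 1) with hg
    have hB₁ : B₁ u = u • B₁ 1 := by rw [← map_smul, smul_eq_mul, mul_one]
    have hB₂ : B₂ v = v • B₂ 1 := by rw [← map_smul, smul_eq_mul, mul_one]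
    have hgR : g = R (B₁ u + B₂ v) := by rw [hB₁, hB₂, map_add, map_smul, map_smul]
    have hfix : A (l • g) + B₁ u + B₂ v = g := by
      have h : g - l • A g = B₁ u + B₂ v := by
        rw [hgR]
        exact DFunLike.congr_fun (Ring.mul_inverse_cancel _ (hunit l hl)) (B₁ u + B₂ v)
      rw [map_smul, add_assoc, ← h, add_sub_cancel]
    have key := hnorm (l • g) u v
    have hC (C : H →L[ℂ] ℂ) (D D' : ℂ) : C (l • g) + D * u + D' * v =
        (D + l * C (R (B₁ 1))) * u + (D' + l * C (R (B₂ 1))) * v := by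
      simp only [hg, map_smul, map_add, smul_eq_mul]
      ring
    rw [hfix, hC, hC, norm_smul, mul_pow] at key
    have hl2 : ‖l‖ ^ 2 ≤ 1 := pow_le_one₀ (norm_nonneg l) (mem_ball_zero_iff.mp hl).le
    nlinarith [mul_le_mul_of_nonneg_right hl2 (sq_nonneg ‖g‖)]
end
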